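/- arXiv:math/9912144 — 5 statements merged into one kernel-verified Lean document; each statement's English description precedes it below -/
import Mathlib

section
/- Let n ≥ 1 be a natural number, let g : ℝ → ℂ be an n-times continuously differentiable function with compact support, let h(z) = ∫_ℝ g(t)·e^{zt} dt be the associated Paley–Wiener function of order n, and fix a ∈ ℂ. Then there exist functions h⁺, h⁻ : ℂ → ℂ and a constant C > 0 such that: h⁺ and h⁻ are complex-differentiable on ℂ ∖ {a}; h(z) = h⁺(z) + h⁻(z) for all z ≠ a; the functions z ↦ (z−a)^{n−1}·h⁺(z) and z ↦ (z−a)^{n−1}·h⁻(z) extend holomorphically across a (i.e. h⁺ and h⁻ have at a at most a pole of order strictly less than n); |h⁺(z)| ≤ C/|z−a|^n for all z ≠ a with Re(z) ≤ 0; and |h⁻(z)| ≤ C/|z−a|^n for all z ≠ a with Re(z) ≥ 0. -/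
open MeasureTheory Set

/-- The two-sided Laplace transform of `f`, with kernel `exp (w * t)`. -/
noncomputable def bilateralLaplace (f : ℝ → ℂ) (w : ℂ) : ℂ :=
  ∫ t : ℝ, f t * Complex.exp (w * t)

theorem norm_mul_cexp_le {f : ℝ → ℂ} {R : ℝ} (hR : ∀ t, f t ≠ 0 → |t| ≤ R) {w : ℂ} {M : ℝ}
    (hw : ‖w‖ ≤ M) (t : ℝ) :
    ‖f t * Complex.exp (w * t)‖ ≤ ‖f t‖ * Real.exp (M * R) := by
  by_cases h0 : f t = 0
  · simp [h0]
  rw [norm_mul]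
  gcongr
  calc ‖Complex.exp (w * t)‖ ≤ Real.exp ‖w * t‖ := Complex.norm_exp_le_exp_norm _
    _ ≤ Real.exp (M * R) := by
      rw [norm_mul, Complex.norm_real, Real.norm_eq_abs]
      have := hR t h0
      have := (norm_nonneg w).trans hw
      gcongr

theorem integrable_mul_cexp {f : ℝ → ℂ} (hf : Integrable f) {R : ℝ}
    (hR : ∀ t, f t ≠ 0 → |t| ≤ R) (w : ℂ) :
    Integrable fun t : ℝ => f t * Complex.exp (w * t) :=
  (hf.norm.mul_const (Real.exp (‖w‖ * R))).mono'
    (hf.aestronglyMeasurable.mul (by fun_prop))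
    (.of_forall fun t => norm_mul_cexp_le hR le_rfl t)

theorem differentiable_bilateralLaplace {f : ℝ → ℂ} (hf : Integrable f) {R : ℝ}
    (hR : ∀ t, f t ≠ 0 → |t| ≤ R) : Differentiable ℂ (bilateralLaplace f) := by
  intro w₀
  refine (hasDerivAt_integral_of_dominated_loc_of_deriv_le
    (F := fun (w : ℂ) (t : ℝ) => f t * Complex.exp (w * t))
    (F' := fun w t => t * (f t * Complex.exp (w * t)))
    (bound := fun t => R * (‖f t‖ * Real.exp ((‖w₀‖ + 1) * R)))
    (Metric.ball_mem_nhds w₀ one_pos)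
    (.of_forall fun w => (integrable_mul_cexp hf hR w).aestronglyMeasurable)
    (integrable_mul_cexp hf hR w₀)
    ((by fun_prop : AEStronglyMeasurable (fun t : ℝ => (t : ℂ)) volume).mul
      (integrable_mul_cexp hf hR w₀).aestronglyMeasurable)
    (.of_forall fun t w hw => ?_)
    ((hf.norm.mul_const _).const_mul _) (.of_forall fun t w _ => ?_)).2.differentiableAt
  · by_cases h0 : f t = 0
    · simp [h0]
    have hw' : ‖w‖ ≤ ‖w₀‖ + 1 := by
      have h1 := norm_le_norm_add_norm_sub w₀ w
      rw [mem_ball_iff_norm'] at hw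
      linarith
    rw [norm_mul, Complex.norm_real, Real.norm_eq_abs]
    have := hR t h0
    exact mul_le_mul this (norm_mul_cexp_le hR hw' t) (norm_nonneg _)
      ((abs_nonneg t).trans this)
  · have h1 : HasDerivAt (fun w : ℂ => w * t) (t : ℂ) w := by
      simpa using (hasDerivAt_id w).mul_const (t : ℂ)
    rw [mul_comm, mul_assoc]
    exact h1.cexp.const_mul (f t)

theorem mul_bilateralLaplace_eq {G : ℝ → ℂ} (hG : ContDiff ℝ 1 G) (hs : HasCompactSupport G)
    (w : ℂ) : w * bilateralLaplace G w = bilateralLaplace (-deriv G) w := by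
  have hGd : Continuous (deriv G) := hG.continuous_deriv le_rfl
  have hv (t : ℝ) : HasDerivAt (fun t : ℝ => Complex.exp (w * t)) (Complex.exp (w * t) * w) t := by
    have h1 : HasDerivAt (fun t : ℝ => w * (t : ℂ)) w t := by
      simpa using (Complex.ofRealCLM.hasDerivAt (x := t)).const_mul w
    exact h1.cexp
  have key := integral_mul_deriv_eq_deriv_mul_of_integrable (u := G) (u' := deriv G)
    (v := fun t : ℝ => Complex.exp (w * t)) (v' := fun t : ℝ => Complex.exp (w * t) * w)
    (fun t _ => (hG.differentiable one_ne_zero t).hasDerivAt) (fun t _ => hv t)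
    (Continuous.integrable_of_hasCompactSupport (by have := hG.continuous; fun_prop) hs.mul_right)
    (Continuous.integrable_of_hasCompactSupport (by fun_prop) hs.deriv.mul_right)
    (Continuous.integrable_of_hasCompactSupport (by have := hG.continuous; fun_prop) hs.mul_right)
  simp only [bilateralLaplace, Pi.neg_apply, neg_mul, integral_neg]
  rw [← key, ← integral_const_mul]
  congr 1
  ext t
  ring

theorem exists_pow_mul_bilateralLaplace_eq (n : ℕ) {G : ℝ → ℂ} (hG : ContDiff ℝ n G)
    (hs : HasCompactSupport G) :
    ∃ k : ℝ → ℂ, Continuous k ∧ HasCompactSupport k ∧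
      ∀ w, w ^ n * bilateralLaplace G w = bilateralLaplace k w := by
  induction n generalizing G with
  | zero => exact ⟨G, hG.continuous, hs, by simp⟩
  | succ n ih =>
    have hd : ContDiff ℝ n (deriv G) := by
      have : ContDiff ℝ (n + 1) G := by exact_mod_cast hG
      exact (contDiff_succ_iff_deriv.1 this).2.2
    obtain ⟨k, hk, hks, hkw⟩ := ih hd.neg hs.deriv.neg
    refine ⟨k, hk, hks, fun w => ?_⟩
    rw [← hkw, pow_succ, mul_assoc, mul_bilateralLaplace_eq (hG.of_le (by simp)) hs]
    rfl

/-- The bound holds on the half-plane where `exp (z * t)` is bounded by one for all `t` in the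
support of `f`. -/
theorem norm_bilateralLaplace_sub_le {f : ℝ → ℂ} (hf : Integrable f) {R : ℝ}
    (hR : ∀ t, f t ≠ 0 → |t| ≤ R) (a : ℂ) {z : ℂ} (hz : ∀ t, f t ≠ 0 → z.re * t ≤ 0) :
    ‖bilateralLaplace f (z - a)‖ ≤ ∫ t, ‖f t‖ * Real.exp (‖a‖ * R) := by
  refine norm_integral_le_of_norm_le (hf.norm.mul_const _) (.of_forall fun t => ?_)
  by_cases h0 : f t = 0
  · simp [h0]
  rw [show (z - a) * t = z * t + -a * t by ring, Complex.exp_add, mul_left_comm, norm_mul]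
  have h1 : ‖Complex.exp (z * t)‖ ≤ 1 := by simpa [Complex.norm_exp] using hz t h0
  exact (mul_le_of_le_one_left (norm_nonneg _) h1).trans
    (norm_mul_cexp_le hR (norm_neg a).le t)

/-- Removing the constant term of `bilateralLaplace f (z - a)` before dividing by `(z - a) ^ n`
leaves a function with a pole of order less than `n`. -/
theorem bilateralLaplace_quotient {f : ℝ → ℂ} (hf : Integrable f) {R : ℝ}
    (hR : ∀ t, f t ≠ 0 → |t| ≤ R) (a : ℂ) {n : ℕ} (hn : 1 ≤ n) :
    ∃ q : ℂ → ℂ,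
      (∀ z, z ≠ a → q z = (bilateralLaplace f (z - a) - bilateralLaplace f 0) / (z - a) ^ n) ∧
      (∀ z, z ≠ a → DifferentiableAt ℂ q z) ∧
      (∃ F : ℂ → ℂ, Differentiable ℂ F ∧ ∀ z, z ≠ a → F z = (z - a) ^ (n - 1) * q z) ∧
      ∃ C : ℝ, 0 < C ∧ ∀ z, z ≠ a → (∀ t, f t ≠ 0 → z.re * t ≤ 0) →
        ‖q z‖ ≤ C / ‖z - a‖ ^ n := by
  have hL : Differentiable ℂ fun z => bilateralLaplace f (z - a) :=
    (differentiable_bilateralLaplace hf hR).comp (differentiable_id.sub_const a)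
  refine ⟨fun z => (bilateralLaplace f (z - a) - bilateralLaplace f 0) / (z - a) ^ n,
    fun _ _ => rfl, fun z hz => ?_, ⟨dslope (fun z => bilateralLaplace f (z - a)) a, ?_, ?_⟩,
    (∫ t, ‖f t‖ * Real.exp (‖a‖ * R)) + ‖bilateralLaplace f 0‖ + 1, by positivity, ?_⟩
  · exact ((hL z).sub_const _).div (by fun_prop) (pow_ne_zero _ (sub_ne_zero.2 hz))
  · rw [← differentiableOn_univ, Complex.differentiableOn_dslope Filter.univ_mem]
    exact hL.differentiableOn
  · intro z hz
    obtain ⟨m, rfl⟩ := Nat.exists_eq_add_of_le' hn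
    have := sub_ne_zero.2 hz
    rw [dslope_of_ne _ hz, slope_def_field, sub_self, Nat.add_sub_cancel]
    field_simp
    ring
  · intro z hz hzt
    rw [norm_div, norm_pow]
    gcongr
    have h1 := norm_bilateralLaplace_sub_le hf hR a hzt
    have h2 := norm_sub_le (bilateralLaplace f (z - a)) (bilateralLaplace f 0)
    linarith


/-- Decomposition of a Paley–Wiener function of order `n` at a point `a`:
`h = h⁺ + h⁻` with `h⁺, h⁻` holomorphic off `a`, having at most a pole of order `< n`
at `a`, and satisfying the bounds `|h⁺(z)| ≤ C/|z-a|^n` on `Re z ≤ 0` and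
`|h⁻(z)| ≤ C/|z-a|^n` on `Re z ≥ 0`. -/
theorem paley_wiener_decomposition
    (n : ℕ) (hn : 1 ≤ n) (g : ℝ → ℂ)
    (hg : ContDiff ℝ n g) (hgsupp : HasCompactSupport g)
    (a : ℂ) (h : ℂ → ℂ)
    (hh : ∀ z : ℂ, h z = ∫ t : ℝ, g t * Complex.exp (z * t)) :
    ∃ (hp hm : ℂ → ℂ) (C : ℝ), 0 < C ∧
      (∀ z : ℂ, z ≠ a → DifferentiableAt ℂ hp z) ∧
      (∀ z : ℂ, z ≠ a → DifferentiableAt ℂ hm z) ∧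
      (∀ z : ℂ, z ≠ a → h z = hp z + hm z) ∧
      (∃ Fp : ℂ → ℂ, Differentiable ℂ Fp ∧
        ∀ z : ℂ, z ≠ a → Fp z = (z - a) ^ (n - 1) * hp z) ∧
      (∃ Fm : ℂ → ℂ, Differentiable ℂ Fm ∧
        ∀ z : ℂ, z ≠ a → Fm z = (z - a) ^ (n - 1) * hm z) ∧
      (∀ z : ℂ, z ≠ a → z.re ≤ 0 → ‖hp z‖ ≤ C / ‖z - a‖ ^ n) ∧
      (∀ z : ℂ, z ≠ a → 0 ≤ z.re → ‖hm z‖ ≤ C / ‖z - a‖ ^ n) := by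
  have hGc : ContDiff ℝ n fun t : ℝ => g t * Complex.exp (a * t) :=
    hg.mul (contDiff_const.mul Complex.ofRealCLM.contDiff).cexp
  obtain ⟨k, hk, hks, hkw⟩ := exists_pow_mul_bilateralLaplace_eq n hGc hgsupp.mul_right
  have hki : Integrable k := hk.integrable_of_hasCompactSupport hks
  obtain ⟨R, hR⟩ : ∃ R, ∀ t, k t ≠ 0 → |t| ≤ R := by
    obtain ⟨R, hR⟩ := hks.isCompact.isBounded.exists_norm_le
    exact ⟨R, fun t ht => hR t (subset_tsupport _ ht)⟩
  have hRs (s : Set ℝ) : ∀ t, s.indicator k t ≠ 0 → |t| ≤ R := fun t ht =>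
    hR t (indicator_apply_ne_zero.1 ht).2
  have hpi : Integrable ((Ici 0).indicator k) := hki.indicator measurableSet_Ici
  have hmi : Integrable ((Ici 0)ᶜ.indicator k) := hki.indicator measurableSet_Ici.compl
  have hsum (w : ℂ) : bilateralLaplace ((Ici 0).indicator k) w
      + bilateralLaplace ((Ici 0)ᶜ.indicator k) w = bilateralLaplace k w := by
    simp only [bilateralLaplace]
    rw [← integral_add (integrable_mul_cexp hpi (hRs _) w) (integrable_mul_cexp hmi (hRs _) w)]
    congr 1
    ext t
    rw [← add_mul, indicator_self_add_compl_apply]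
  have hk0 : bilateralLaplace k 0 = 0 := by
    rw [← hkw, zero_pow (by omega), zero_mul]
  have hh' (z : ℂ) : (z - a) ^ n * h z = bilateralLaplace k (z - a) := by
    rw [← hkw, hh]
    congr 2
    ext t
    rw [mul_assoc, ← Complex.exp_add]
    ring_nf
  obtain ⟨hp, hpq, hpd, hpF, Cp, hCp, hpb⟩ := bilateralLaplace_quotient hpi (hRs _) a hn
  obtain ⟨hm, hmq, hmd, hmF, Cm, hCm, hmb⟩ := bilateralLaplace_quotient hmi (hRs _) a hn
  refine ⟨hp, hm, Cp + Cm, by positivity, hpd, hmd, fun z hz => ?_, hpF, hmF,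
    fun z hz hre => (hpb z hz fun t ht => ?_).trans (by gcongr; linarith),
    fun z hz hre => (hmb z hz fun t ht => ?_).trans (by gcongr; linarith)⟩
  · rw [hpq z hz, hmq z hz, ← add_div, eq_div_iff (pow_ne_zero _ (sub_ne_zero.2 hz))]
    linear_combination hh' z - hsum (z - a) + hsum 0 + hk0
  · exact mul_nonpos_of_nonpos_of_nonneg hre (indicator_apply_ne_zero.1 ht).1
  · exact mul_nonpos_of_nonneg_of_nonpos hre
      (show t < 0 by simpa using (indicator_apply_ne_zero.1 ht).1).le
end

section
/- Let n ≥ 1 be a natural number and a ∈ ℂ. Suppose h : ℂ → ℂ admits two decompositions h = h₁⁺ + h₁⁻ = h₂⁺ + h₂⁻ on ℂ ∖ {a}, where for i = 1,2 the functions hᵢ⁺, hᵢ⁻ are complex-differentiable on ℂ ∖ {a}, the functions (z−a)^{n−1}·hᵢ^±(z) extend holomorphically across a, and there are constants Cᵢ > 0 with |hᵢ⁺(z)| ≤ Cᵢ/|z−a|^n for all z ≠ a with Re(z) ≤ 0 and |hᵢ⁻(z)| ≤ Cᵢ/|z−a|^n for all z ≠ a with Re(z) ≥ 0. Then h₁⁺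 = h₂⁺ and h₁⁻ = h₂⁻ on ℂ ∖ {a}. -/
/-- An entire function bounded by `C / ‖z - a‖` away from `a` vanishes identically. -/
theorem entire_eq_zero_of_norm_le_div {F : ℂ → ℂ} (hF : Differentiable ℂ F) {a : ℂ} {C : ℝ}
    (hbd : ∀ z, z ≠ a → ‖F z‖ ≤ C / ‖z - a‖) (z : ℂ) : F z = 0 := by
  refine hF.apply_eq_of_tendsto_cocompact z (squeeze_zero_norm' (a := fun w => C / ‖w - a‖) ?_ ?_)
  · filter_upwards [(isCompact_singleton (x := a)).compl_mem_cocompact] with w hw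
    exact hbd w hw
  · refine Filter.Tendsto.div_atTop tendsto_const_nhds ?_
    exact tendsto_norm_cocompact_atTop.comp
      (Homeomorph.subRight a).isClosedEmbedding.tendsto_cocompact

theorem norm_pow_pred_mul_sub_le {n : ℕ} (hn : 1 ≤ n) {w u v : ℂ} (hw : w ≠ 0) {C D : ℝ}
    (hu : ‖u‖ ≤ C / ‖w‖ ^ n) (hv : ‖v‖ ≤ D / ‖w‖ ^ n) :
    ‖w ^ (n - 1) * (u - v)‖ ≤ (C + D) / ‖w‖ := by
  obtain ⟨m, rfl⟩ : ∃ m, n = m + 1 := ⟨n - 1, by omega⟩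
  have hw' : 0 < ‖w‖ := norm_pos_iff.mpr hw
  rw [norm_mul, norm_pow, Nat.add_sub_cancel]
  calc ‖w‖ ^ m * ‖u - v‖ ≤ ‖w‖ ^ m * (C / ‖w‖ ^ (m + 1) + D / ‖w‖ ^ (m + 1)) := by
        gcongr
        exact (norm_sub_le u v).trans (add_le_add hu hv)
    _ = (C + D) / ‖w‖ := by
        field_simp
        ring

/-- Uniqueness of the decomposition `h = h⁺ + h⁻` of a function at a point `a`,
where `h⁺, h⁻` are holomorphic off `a`, have at most a pole of order `< n` at `a`,
and satisfy `|h⁺(z)| ≤ C/|z-a|^n` for `Re z ≤ 0` and `|h⁻(z)| ≤ C/|z-a|^n` for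
`Re z ≥ 0`. -/
theorem paley_wiener_decomposition_unique
    (n : ℕ) (hn : 1 ≤ n) (a : ℂ) (h h₁p h₁m h₂p h₂m : ℂ → ℂ)
    -- decomposition 1
    (h₁p_diff : ∀ z : ℂ, z ≠ a → DifferentiableAt ℂ h₁p z)
    (h₁m_diff : ∀ z : ℂ, z ≠ a → DifferentiableAt ℂ h₁m z)
    (h₁sum : ∀ z : ℂ, z ≠ a → h z = h₁p z + h₁m z)
    (h₁p_pole : ∃ Fp : ℂ → ℂ, Differentiable ℂ Fp ∧
      ∀ z : ℂ, z ≠ a → Fp z = (z - a) ^ (n - 1) * h₁p z)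
    (h₁m_pole : ∃ Fm : ℂ → ℂ, Differentiable ℂ Fm ∧
      ∀ z : ℂ, z ≠ a → Fm z = (z - a) ^ (n - 1) * h₁m z)
    (C₁ : ℝ) (hC₁ : 0 < C₁)
    (h₁p_bd : ∀ z : ℂ, z ≠ a → z.re ≤ 0 → ‖h₁p z‖ ≤ C₁ / ‖z - a‖ ^ n)
    (h₁m_bd : ∀ z : ℂ, z ≠ a → 0 ≤ z.re → ‖h₁m z‖ ≤ C₁ / ‖z - a‖ ^ n)
    -- decomposition 2
    (h₂p_diff : ∀ z : ℂ, z ≠ a → DifferentiableAt ℂ h₂p z)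
    (h₂m_diff : ∀ z : ℂ, z ≠ a → DifferentiableAt ℂ h₂m z)
    (h₂sum : ∀ z : ℂ, z ≠ a → h z = h₂p z + h₂m z)
    (h₂p_pole : ∃ Fp : ℂ → ℂ, Differentiable ℂ Fp ∧
      ∀ z : ℂ, z ≠ a → Fp z = (z - a) ^ (n - 1) * h₂p z)
    (h₂m_pole : ∃ Fm : ℂ → ℂ, Differentiable ℂ Fm ∧
      ∀ z : ℂ, z ≠ a → Fm z = (z - a) ^ (n - 1) * h₂m z)
    (C₂ : ℝ) (hC₂ : 0 < C₂)
    (h₂p_bd : ∀ z : ℂ, z ≠ a → z.re ≤ 0 → ‖h₂p z‖ ≤ C₂ / ‖z - a‖ ^ n)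
    (h₂m_bd : ∀ z : ℂ, z ≠ a → 0 ≤ z.re → ‖h₂m z‖ ≤ C₂ / ‖z - a‖ ^ n) :
    (∀ z : ℂ, z ≠ a → h₁p z = h₂p z) ∧ (∀ z : ℂ, z ≠ a → h₁m z = h₂m z) := by
  obtain ⟨F₁, hF₁, hF₁_eq⟩ := h₁p_pole
  obtain ⟨F₂, hF₂, hF₂_eq⟩ := h₂p_pole
  have key : ∀ z, z ≠ a → (F₁ - F₂) z = (z - a) ^ (n - 1) * (h₁p z - h₂p z) := by
    intro z hz
    rw [Pi.sub_apply, hF₁_eq z hz, hF₂_eq z hz, mul_sub]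
  have sum_eq : ∀ z, z ≠ a → h₁p z + h₁m z = h₂p z + h₂m z := fun z hz =>
    (h₁sum z hz).symm.trans (h₂sum z hz)
  have bound : ∀ z, z ≠ a → ‖(F₁ - F₂) z‖ ≤ (C₁ + C₂) / ‖z - a‖ := by
    intro z hz
    rw [key z hz]
    rcases le_total z.re 0 with hre | hre
    · exact norm_pow_pred_mul_sub_le hn (sub_ne_zero.mpr hz) (h₁p_bd z hz hre) (h₂p_bd z hz hre)
    · have hswap : h₁p z - h₂p z = h₂m z - h₁m z := by linear_combination sum_eq z hz
      rw [hswap, add_comm C₁]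
      exact norm_pow_pred_mul_sub_le hn (sub_ne_zero.mpr hz) (h₂m_bd z hz hre) (h₁m_bd z hz hre)
  have plus_eq : ∀ z, z ≠ a → h₁p z = h₂p z := by
    intro z hz
    have hzero := (key z hz).symm.trans (entire_eq_zero_of_norm_le_div (hF₁.sub hF₂) bound z)
    exact sub_eq_zero.mp
      ((mul_eq_zero.mp hzero).resolve_left (pow_ne_zero _ (sub_ne_zero.mpr hz)))
  exact ⟨plus_eq, fun z hz => by linear_combination sum_eq z hz - plus_eq z hz⟩
end

section
/- Let n ≥ 1 be a natural number and let g : ℝ → ℂ be an n-times continuously differentiable function with compact support such that g^{(k)}(0) = 0 for all 0 ≤ k ≤ n. Define h(z) = ∫_ℝ g(t)·e^{zt} dt, h⁺(z) = ∫_0^∞ g(t)·e^{zt} dt and h⁻(z) = ∫_{−∞}^0 g(t)·e^{zt} dt. Then h⁺ and h⁻ are entire, h = h⁺ + h⁻, and there exists C > 0 such that |h⁺(z)| ≤ C/|z|^n for all z ≠ 0 with Re(z) ≤ 0 and |h⁻(z)| ≤ C/|z|^n for all z ≠ 0 with Re(z) ≥ 0. (Hence, when g vanishes at 0 to order larger than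 n, the decomposition of the Paley–Wiener function h at a = 0 is given by these two explicit holomorphic functions.) -/
open MeasureTheory

lemma hasCompactSupport_iteratedDeriv {g : ℝ → ℂ} (hgs : HasCompactSupport g) (n : ℕ) :
    HasCompactSupport (iteratedDeriv n g) := by
  induction n with
  | zero => simpa using hgs
  | succ n ih => simpa only [iteratedDeriv_succ] using ih.deriv

/-- Restricting the Laplace integral of a continuous, compactly supported function to any set
gives an entire function. -/
lemma differentiable_setIntegral_mul_cexp {g : ℝ → ℂ} (hg : Continuous g)
    (hgs : HasCompactSupport g) (s : Set ℝ) :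
    Differentiable ℂ fun z : ℂ => ∫ t in s, g t * Complex.exp (z * t) := by
  intro z₀
  have hcont (z : ℂ) : Continuous fun t : ℝ => g t * Complex.exp (z * t) := by fun_prop
  have key := hasDerivAt_integral_of_dominated_loc_of_deriv_le
    (μ := volume.restrict s) (x₀ := z₀) (s := Metric.ball z₀ 1)
    (F := fun (z : ℂ) (t : ℝ) => g t * Complex.exp (z * t))
    (F' := fun (z : ℂ) (t : ℝ) => g t * (Complex.exp (z * t) * t))
    (bound := fun t : ℝ => ‖g t‖ * (Real.exp ((‖z₀‖ + 1) * |t|) * |t|))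
    (Metric.ball_mem_nhds z₀ one_pos)
    (.of_forall fun z => (hcont z).aestronglyMeasurable)
    ((hcont z₀).integrable_of_hasCompactSupport hgs.mul_right).integrableOn
    (by fun_prop)
    (.of_forall fun t z hz => ?_)
    (Continuous.integrable_of_hasCompactSupport (by fun_prop) hgs.norm.mul_right).integrableOn
    (.of_forall fun t z _ => ?_)
  · exact key.2.differentiableAt
  · rw [norm_mul, norm_mul, Complex.norm_exp, Complex.norm_real, Real.norm_eq_abs]
    gcongr
    have hz' : ‖z‖ ≤ ‖z₀‖ + 1 := by
      have := norm_le_norm_add_norm_sub' z z₀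
      rw [mem_ball_iff_norm] at hz
      linarith
    calc (z * t).re ≤ ‖z * t‖ := Complex.re_le_norm _
      _ = ‖z‖ * |t| := by simp
      _ ≤ _ := by gcongr
  · have := ((hasDerivAt_id z).mul_const (t : ℂ)).cexp.const_mul (g t)
    simpa using this

/-- Iterated integration by parts over a set `s` on which derivatives of compactly supported
functions vanishing at `0` integrate to zero. -/
lemma pow_mul_setIntegral_mul_cexp {s : Set ℝ}
    (hs : ∀ f : ℝ → ℂ, ContDiff ℝ 1 f → HasCompactSupport f → f 0 = 0 →
      ∫ t in s, deriv f t = 0) (z : ℂ) (n : ℕ) (g : ℝ → ℂ) (hg : ContDiff ℝ n g)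
    (hgs : HasCompactSupport g) (h0 : ∀ k < n, iteratedDeriv k g 0 = 0) :
    z ^ n * ∫ t in s, g t * Complex.exp (z * t) =
      (-1) ^ n * ∫ t in s, iteratedDeriv n g t * Complex.exp (z * t) := by
  induction n generalizing g with
  | zero => simp
  | succ n ih =>
    have hg' : ContDiff ℝ (n + 1) g := by exact_mod_cast hg
    have hg1 : ContDiff ℝ 1 g := hg'.of_le (by simp)
    have hdg : ContDiff ℝ n (deriv g) := (contDiff_succ_iff_deriv.mp hg').2.2
    have hexp : ContDiff ℝ 1 fun t : ℝ => Complex.exp (z * t) :=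
      (contDiff_const.mul Complex.ofRealCLM.contDiff).cexp
    have hderiv (t : ℝ) : deriv (fun t : ℝ => g t * Complex.exp (z * t)) t =
        deriv g t * Complex.exp (z * t) + z * (g t * Complex.exp (z * t)) := by
      have h1 := (hg1.differentiable one_ne_zero t).hasDerivAt
      have h2 := ((hasDerivAt_id t).ofReal_comp.const_mul z).cexp
      simp only [id, Complex.ofReal_one, mul_one] at h2
      refine (h1.mul h2).deriv.trans ?_
      ring
    have hint {f : ℝ → ℂ} (hf : Continuous f) (hfs : HasCompactSupport f) :
        IntegrableOn (fun t : ℝ => f t * Complex.exp (z * t)) s :=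
      (Continuous.integrable_of_hasCompactSupport (by fun_prop) hfs.mul_right).integrableOn
    have hzero := hs _ (hg1.mul hexp) hgs.mul_right
      (by simpa using h0 0 n.succ_pos)
    simp only [hderiv] at hzero
    rw [integral_add (hint hdg.continuous hgs.deriv) ((hint hg1.continuous hgs).const_mul z),
      integral_const_mul] at hzero
    have := ih (deriv g) hdg hgs.deriv fun k hk => by
      rw [← iteratedDeriv_succ']
      exact h0 _ (by lia)
    rw [iteratedDeriv_succ', pow_succ (-1 : ℂ), mul_right_comm, ← this, pow_succ]
    linear_combination z ^ n * hzero

/-- Decay of the Laplace integral over a set where `e^{zt}` is bounded by `1`. -/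
lemma norm_setIntegral_mul_cexp_le {s : Set ℝ} (hsm : MeasurableSet s)
    (hs : ∀ f : ℝ → ℂ, ContDiff ℝ 1 f → HasCompactSupport f → f 0 = 0 →
      ∫ t in s, deriv f t = 0) {n : ℕ} {g : ℝ → ℂ} (hg : ContDiff ℝ n g)
    (hgs : HasCompactSupport g) (h0 : ∀ k < n, iteratedDeriv k g 0 = 0) {z : ℂ} (hz : z ≠ 0)
    (hre : ∀ t ∈ s, z.re * t ≤ 0) :
    ‖∫ t in s, g t * Complex.exp (z * t)‖ ≤ (∫ t, ‖iteratedDeriv n g t‖) / ‖z‖ ^ n := by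
  have hint : Integrable fun t => ‖iteratedDeriv n g t‖ :=
    ((hg.continuous_iteratedDeriv n le_rfl).integrable_of_hasCompactSupport
      (hasCompactSupport_iteratedDeriv hgs n)).norm
  rw [le_div_iff₀ (pow_pos (norm_pos_iff.mpr hz) n)]
  calc ‖∫ t in s, g t * Complex.exp (z * t)‖ * ‖z‖ ^ n
      = ‖∫ t in s, iteratedDeriv n g t * Complex.exp (z * t)‖ := by
        simpa [mul_comm] using
          congrArg norm (pow_mul_setIntegral_mul_cexp hs z n g hg hgs h0)
    _ ≤ ∫ t in s, ‖iteratedDeriv n g t‖ := by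
        refine norm_integral_le_of_norm_le hint.integrableOn
          ((ae_restrict_mem hsm).mono fun t ht => ?_)
        rw [norm_mul, Complex.norm_exp]
        refine mul_le_of_le_one_right (norm_nonneg _) (Real.exp_le_one_iff.mpr ?_)
        simpa using hre t ht
    _ ≤ ∫ t, ‖iteratedDeriv n g t‖ :=
        setIntegral_le_integral hint (.of_forall fun _ => norm_nonneg _)

/-- If `g` is `Cⁿ` with compact support and vanishes at `0` to order greater than `n`
(i.e. `g(0) = g'(0) = ⋯ = g⁽ⁿ⁾(0) = 0`), then the Paley–Wiener function
`h(z) = ∫_ℝ g(t) e^{zt} dt` decomposes at `a = 0` as the sum of the entire functions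
`h⁺(z) = ∫_0^∞ g(t) e^{zt} dt` and `h⁻(z) = ∫_{-∞}^0 g(t) e^{zt} dt`, with the bounds
`|h⁺(z)| ≤ C/|z|^n` for `Re z ≤ 0` and `|h⁻(z)| ≤ C/|z|^n` for `Re z ≥ 0`. -/
theorem paley_wiener_decomposition_explicit
    (n : ℕ) (hn : 1 ≤ n) (g : ℝ → ℂ)
    (hg : ContDiff ℝ n g) (hgsupp : HasCompactSupport g)
    (hvanish : ∀ k : ℕ, k ≤ n → iteratedDeriv k g 0 = 0)
    (h hp hm : ℂ → ℂ)
    (hh : ∀ z : ℂ, h z = ∫ t : ℝ, g t * Complex.exp (z * t))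
    (hhp : ∀ z : ℂ, hp z = ∫ t in Set.Ioi (0 : ℝ), g t * Complex.exp (z * t))
    (hhm : ∀ z : ℂ, hm z = ∫ t in Set.Iio (0 : ℝ), g t * Complex.exp (z * t)) :
    Differentiable ℂ hp ∧ Differentiable ℂ hm ∧
      (∀ z : ℂ, h z = hp z + hm z) ∧
      ∃ C : ℝ, 0 < C ∧
        (∀ z : ℂ, z ≠ 0 → z.re ≤ 0 → ‖hp z‖ ≤ C / ‖z‖ ^ n) ∧
        (∀ z : ℂ, z ≠ 0 → 0 ≤ z.re → ‖hm z‖ ≤ C / ‖z‖ ^ n) := by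
  have hcont := hg.continuous
  have hlt : ∀ k < n, iteratedDeriv k g 0 = 0 := fun k hk => hvanish k hk.le
  have hIoi : ∀ f : ℝ → ℂ, ContDiff ℝ 1 f → HasCompactSupport f → f 0 = 0 →
      ∫ t in Set.Ioi (0 : ℝ), deriv f t = 0 := fun f hf hfs hf0 => by
    rw [hfs.integral_Ioi_deriv_eq hf, hf0, neg_zero]
  have hIio : ∀ f : ℝ → ℂ, ContDiff ℝ 1 f → HasCompactSupport f → f 0 = 0 →
      ∫ t in Set.Iio (0 : ℝ), deriv f t = 0 := fun f hf hfs hf0 => by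
    rw [← integral_Iic_eq_integral_Iio, hfs.integral_Iic_deriv_eq hf, hf0]
  have hI : 0 ≤ ∫ t, ‖iteratedDeriv n g t‖ := integral_nonneg fun _ => norm_nonneg _
  refine ⟨?_, ?_, fun z => ?_, (∫ t, ‖iteratedDeriv n g t‖) + 1, by linarith,
    fun z hz hre => ?_, fun z hz hre => ?_⟩
  · rw [funext hhp]
    exact differentiable_setIntegral_mul_cexp hcont hgsupp _
  · rw [funext hhm]
    exact differentiable_setIntegral_mul_cexp hcont hgsupp _
  · have hint : Integrable fun t : ℝ => g t * Complex.exp (z * t) :=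
      Continuous.integrable_of_hasCompactSupport (by fun_prop) hgsupp.mul_right
    rw [hh, hhp, hhm, ← integral_Iic_eq_integral_Iio, add_comm,
      intervalIntegral.integral_Iic_add_Ioi hint.integrableOn hint.integrableOn]
  · rw [hhp]
    refine (norm_setIntegral_mul_cexp_le measurableSet_Ioi hIoi hg hgsupp hlt hz
      fun t ht => mul_nonpos_of_nonpos_of_nonneg hre (le_of_lt ht)).trans ?_
    gcongr
    linarith
  · rw [hhm]
    refine (norm_setIntegral_mul_cexp_le measurableSet_Iio hIio hg hgsupp hlt hz
      fun t ht => mul_nonpos_of_nonneg_of_nonpos hre (le_of_lt ht)).trans ?_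
    gcongr
    linarith
end

section
/- Let m ≥ 1, λ₀ ∈ ℂ, and let A : ℂ → Matrix (Fin m) (Fin m) ℂ be a matrix-valued function such that: every entry of A is complex-differentiable on a punctured neighborhood U ∖ {λ₀} of λ₀; every entry of A is meromorphic at λ₀ (i.e. there is N ∈ ℕ such that each entry of (z−λ₀)^N·A(z) extends holomorphically across λ₀); and the function z ↦ det(A(z)) is not identically zero on any punctured neighborhood of λ₀. Let A'(z) denote the entrywise derivative of A at z. Then there exist an integer d ∈ ℤ, a neighborhood V of λ₀, and a holomorphic function ψ on V such that trace(A(z)⁻¹ · A'(z)) = d/(z−λ₀) + ψ(z) for all z ∈ V with z ≠ λ₀ and det(A(z)) ≠ 0. In particular the residue at λ₀ of trace(A(λ)⁻¹A'(λ)) is an integer. -/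
open Topology

/-- **Jacobi's formula**: the derivative of the determinant of a matrix of differentiable functions
is the trace of the adjugate times the entrywise derivative. -/
theorem hasDerivAt_matrix_det {𝕜 n : Type*} [NontriviallyNormedField 𝕜] [Fintype n]
    [DecidableEq n] {A : 𝕜 → Matrix n n 𝕜} {A' : Matrix n n 𝕜} {z : 𝕜}
    (hA : ∀ i j, HasDerivAt (fun w => A w i j) (A' i j) z) :
    HasDerivAt (fun w => (A w).det) (Matrix.trace ((A z).adjugate * A')) z := by
  let D : ContinuousMultilinearMap 𝕜 (fun _ : n => n → 𝕜) 𝕜 :=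
    { (Matrix.detRowAlternating (R := 𝕜) (n := n)).toMultilinearMap with
      cont := Continuous.matrix_det (A := fun M : n → n → 𝕜 => Matrix.of M) continuous_id }
  have hD : HasDerivAt (fun w => D (A w)) (D.linearDeriv (A z) A') z :=
    (D.hasFDerivAt (A z)).comp_hasDerivAt z
      (hasDerivAt_pi.2 fun i => hasDerivAt_pi.2 fun j => hA i j)
  refine hD.congr_deriv ?_
  calc D.linearDeriv (A z) A' = ∑ i, ((A z).updateRow i (A' i)).det :=
        D.linearDeriv_apply (A z) A'
    _ = ∑ i, (A' * (A z).adjugate) i i := by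
        refine Finset.sum_congr rfl fun i _ => ?_
        rw [← Matrix.cramer_transpose_apply, Matrix.cramer_eq_adjugate_mulVec,
          ← Matrix.adjugate_transpose, Matrix.mulVec_transpose]
        rfl
    _ = Matrix.trace ((A z).adjugate * A') := Matrix.trace_mul_comm _ _

/-- `tr(A⁻¹ A')` is the logarithmic derivative of `det A`; both sides are zero by convention where
`A` is singular. -/
theorem trace_inv_mul_eq_logDeriv_det {𝕜 n : Type*} [NontriviallyNormedField 𝕜] [Fintype n]
    [DecidableEq n] {A : 𝕜 → Matrix n n 𝕜} {A' : Matrix n n 𝕜} {z : 𝕜}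
    (hA : ∀ i j, HasDerivAt (fun w => A w i j) (A' i j) z) :
    Matrix.trace ((A z)⁻¹ * A') = logDeriv (fun w => (A w).det) z := by
  rw [logDeriv_apply, (hasDerivAt_matrix_det hA).deriv, Matrix.inv_def, Ring.inverse_eq_inv',
    Matrix.smul_mul, Matrix.trace_smul, smul_eq_mul, div_eq_inv_mul]

/-- The determinant of a matrix of meromorphic functions is meromorphic. -/
theorem MeromorphicAt.matrix_det {𝕜 n : Type*} [NontriviallyNormedField 𝕜] [Fintype n]
    [DecidableEq n] {A : 𝕜 → Matrix n n 𝕜} {z : 𝕜}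
    (hA : ∀ i j, MeromorphicAt (fun w => A w i j) z) :
    MeromorphicAt (fun w => (A w).det) z := by
  simp only [Matrix.det_apply']
  exact MeromorphicAt.fun_sum fun σ _ =>
    (MeromorphicAt.const _ z).mul (MeromorphicAt.fun_prod fun i _ => hA (σ i) i)

/-- The logarithmic derivative of a meromorphic function that does not vanish identically has at
most a simple pole, with integer residue. -/
theorem MeromorphicAt.exists_logDeriv_eq {f : ℂ → ℂ} {x : ℂ} (hf : MeromorphicAt f x)
    (hne : ∃ᶠ z in 𝓝[≠] x, f z ≠ 0) :
    ∃ (d : ℤ) (ψ : ℂ → ℂ), AnalyticAt ℂ ψ x ∧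
      ∀ᶠ z in 𝓝[≠] x, _root_.logDeriv f z = d / (z - x) + ψ z := by
  have htop : meromorphicOrderAt f x ≠ ⊤ := fun h =>
    hne ((meromorphicOrderAt_eq_top_iff.1 h).mono fun _ hz => not_not.2 hz)
  obtain ⟨g, hg, hgx, hfg⟩ := (meromorphicOrderAt_ne_top_iff hf).1 htop
  refine ⟨(meromorphicOrderAt f x).untop₀, _root_.logDeriv g, hg.deriv.div hg hgx, ?_⟩
  filter_upwards [hfg, hfg.nhdsNE_deriv, self_mem_nhdsWithin,
    hg.eventually_analyticAt.filter_mono nhdsWithin_le_nhds,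
    (hg.continuousAt.eventually_ne hgx).filter_mono nhdsWithin_le_nhds] with z h h' hz hgz hgz0
  have hzx : z - x ≠ 0 := sub_ne_zero.2 hz
  rw [logDeriv_apply, h, h', ← logDeriv_apply]
  simp only [smul_eq_mul]
  rw [logDeriv_mul (f := fun w => (w - x) ^ (meromorphicOrderAt f x).untop₀) z
    (zpow_ne_zero _ hzx) hgz0 ((differentiableAt_id.sub_const x).zpow (Or.inl hzx))
    hgz.differentiableAt,
    logDeriv_fun_zpow (by fun_prop)]
  simp [logDeriv_apply, div_eq_mul_inv]

/-- A function that is differentiable on a punctured neighborhood and becomes differentiable after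
multiplication by a power of `z - x` is meromorphic. -/
theorem meromorphicAt_of_differentiableAt_pow_mul {f F : ℂ → ℂ} {x : ℂ} {U : Set ℂ}
    (hU : U ∈ 𝓝 x) (hf : ∀ z ∈ U \ {x}, DifferentiableAt ℂ f z) {N : ℕ}
    (hF : DifferentiableAt ℂ F x) (hFf : ∀ z ∈ U \ {x}, F z = (z - x) ^ N * f z) :
    MeromorphicAt f x := by
  have hFan : AnalyticAt ℂ F x := by
    rw [Complex.analyticAt_iff_eventually_differentiableAt]
    filter_upwards [eventually_mem_nhds_iff.2 hU] with z hz
    rcases eq_or_ne z x with rfl | hzx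
    · exact hF
    · have heq : F =ᶠ[𝓝 z] fun w => (w - x) ^ N * f w := by
        filter_upwards [hz, isOpen_ne.mem_nhds hzx] with w hw hwx using hFf w ⟨hw, hwx⟩
      refine DifferentiableAt.congr_of_eventuallyEq ?_ heq
      exact ((differentiableAt_id.sub_const x).pow N).mul (hf z ⟨mem_of_mem_nhds hz, hzx⟩)
  have hpow : MeromorphicAt (fun z => (z - x) ^ N) x :=
    AnalyticAt.meromorphicAt (by fun_prop)
  refine (hFan.meromorphicAt.div hpow).congr ?_
  filter_upwards [self_mem_nhdsWithin, mem_nhdsWithin_of_mem_nhds hU] with z hz hzU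
  have hzx : z - x ≠ 0 := sub_ne_zero.2 hz
  rw [Pi.div_apply, hFf z ⟨hzU, hz⟩, mul_div_cancel_left₀ _ (pow_ne_zero _ hzx)]

/-- For a matrix-valued meromorphic function `A` whose determinant is not identically
zero near `λ₀`, the residue at `λ₀` of `tr(A(z)⁻¹ A'(z))` is an integer: near `λ₀` one
has `tr(A(z)⁻¹ A'(z)) = d/(z-λ₀) + ψ(z)` with `d ∈ ℤ` and `ψ` holomorphic. -/
theorem residue_of_matrix_logarithmic_derivative_is_integer
    (m : ℕ) (hm : 1 ≤ m) (lam₀ : ℂ)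
    (A : ℂ → Matrix (Fin m) (Fin m) ℂ) (U : Set ℂ) (hU : U ∈ nhds lam₀)
    (hdiff : ∀ (i j : Fin m), ∀ z ∈ U \ {lam₀},
      DifferentiableAt ℂ (fun w => A w i j) z)
    (hmero : ∃ N : ℕ, ∀ i j : Fin m, ∃ F : ℂ → ℂ, DifferentiableAt ℂ F lam₀ ∧
      ∀ z ∈ U \ {lam₀}, F z = (z - lam₀) ^ N * A z i j)
    (hne : ∃ᶠ z in nhdsWithin lam₀ {lam₀}ᶜ, (A z).det ≠ 0) :
    ∃ (d : ℤ) (V : Set ℂ), V ∈ nhds lam₀ ∧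
      ∃ ψ : ℂ → ℂ, DifferentiableOn ℂ ψ V ∧
        ∀ z ∈ V, z ≠ lam₀ → (A z).det ≠ 0 →
          Matrix.trace ((A z)⁻¹ * Matrix.of (fun i j => deriv (fun w => A w i j) z))
            = (d : ℂ) / (z - lam₀) + ψ z := by
  obtain ⟨N, hN⟩ := hmero
  have hA (i j : Fin m) : MeromorphicAt (fun w => A w i j) lam₀ := by
    obtain ⟨F, hF, hFA⟩ := hN i j
    exact meromorphicAt_of_differentiableAt_pow_mul hU (hdiff i j) hF hFA
  obtain ⟨d, ψ, hψ, hlog⟩ := (MeromorphicAt.matrix_det hA).exists_logDeriv_eq hne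
  refine ⟨d, {z | AnalyticAt ℂ ψ z ∧ z ∈ U ∧
      (z ≠ lam₀ → logDeriv (fun w => (A w).det) z = d / (z - lam₀) + ψ z)}, ?_, ψ,
    fun z hz => hz.1.differentiableAt.differentiableWithinAt, ?_⟩
  · filter_upwards [hψ.eventually_analyticAt, hU, eventually_nhdsWithin_iff.1 hlog]
      with z hz hzU hzlog using ⟨hz, hzU, hzlog⟩
  · rintro z ⟨-, hzU, hz⟩ hzx -
    rw [← hz hzx]
    exact trace_inv_mul_eq_logDeriv_det fun i j => (hdiff i j z ⟨hzU, hzx⟩).hasDerivAt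
end

section
/- Let f : ℂ → ℂ be an entire function, not identically zero, of finite order: there exist ρ ≥ 0 and C > 0 with |f(z)| ≤ C·exp(|z|^ρ) for all z ∈ ℂ. Let N be a natural number with N ≥ ρ + 2. Then f'/f is essentially of moderate growth with growth exponent N: there exist a constant C' > 0, a sequence of points a : ℕ → ℂ, and a sequence of radii r : ℕ → ℝ with r_k > 0 for all k and r_k → 0 as k → ∞, such that the closed disks B̄(a_k, r_k) are pairwise disjoint, every zero of f lies in some disk B̄(a_k, r_k), and |f'(z)/f(z)| ≤ C'·|z|^N for every z outside the union ⋃_k B̄(a_k, r_k). -/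
open Filter Metric

theorem exists_eq_pow_mul_of_analyticOrderAt_ne_top {g : ℂ → ℂ} (hg : Differentiable ℂ g) {b : ℂ}
    (hb : analyticOrderAt g b ≠ ⊤) :
    ∃ h : ℂ → ℂ, Differentiable ℂ h ∧ h b ≠ 0 ∧
      ∀ z, g z = (z - b) ^ analyticOrderNatAt g b * h z := by
  obtain ⟨k, hk, hkb, hgk⟩ := (hg.analyticAt b).analyticOrderAt_ne_top.1 hb
  set n := analyticOrderNatAt g b
  have hgk' : ∀ᶠ z in nhds b,
      Function.update (fun z => g z / (z - b) ^ n) b (k b) z = k z := by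
    filter_upwards [hgk] with z hz
    rcases eq_or_ne z b with rfl | hne
    · simp
    · have : (z - b) ^ n ≠ 0 := pow_ne_zero _ (sub_ne_zero.2 hne)
      simp only [Function.update_of_ne hne]
      rw [hz, smul_eq_mul, mul_div_cancel_left₀ _ this]
  refine ⟨Function.update (fun z => g z / (z - b) ^ n) b (k b), fun z => ?_, by simpa, fun z => ?_⟩
  · rcases eq_or_ne z b with rfl | hne
    · exact hk.differentiableAt.congr_of_eventuallyEq hgk'
    · have h1 : DifferentiableAt ℂ (fun z => g z / (z - b) ^ n) z :=
        (hg z).div (by fun_prop) (pow_ne_zero _ (sub_ne_zero.2 hne))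
      refine h1.congr_of_eventuallyEq ?_
      filter_upwards [isOpen_ne.mem_nhds hne] with w hw
      simp [Function.update_of_ne hw]
  · rcases eq_or_ne z b with rfl | hne
    · simpa using hgk.self_of_nhds
    · have : (z - b) ^ n ≠ 0 := pow_ne_zero _ (sub_ne_zero.2 hne)
      simp only [Function.update_of_ne hne]
      rw [mul_div_cancel₀ _ this]

theorem analyticOrderAt_ne_top_of_differentiable {f : ℂ → ℂ} (hf : Differentiable ℂ f)
    (h0 : f 0 ≠ 0) (a : ℂ) : analyticOrderAt f a ≠ ⊤ := by
  intro h
  rw [analyticOrderAt_eq_top] at h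
  have := AnalyticOnNhd.eqOn_zero_of_preconnected_of_eventuallyEq_zero
    (f := f) (U := Set.univ) (fun z _ => hf.analyticAt z) isPreconnected_univ (Set.mem_univ a) h
  exact h0 (this (Set.mem_univ 0))

theorem exists_eq_prod_pow_mul {f : ℂ → ℂ} (hf : Differentiable ℂ f) (h0 : f 0 ≠ 0)
    (Z : Finset ℂ) :
    ∃ g : ℂ → ℂ, Differentiable ℂ g ∧ (∀ a ∈ Z, g a ≠ 0) ∧
      ∀ z, f z = (∏ a ∈ Z, (z - a) ^ analyticOrderNatAt f a) * g z := by
  classical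
  induction Z using Finset.induction_on with
  | empty => exact ⟨f, hf, by simp, by simp⟩
  | insert b Z hb ih =>
    obtain ⟨g, hg, hgne, hfg⟩ := ih
    have hP : Differentiable ℂ (fun z => ∏ a ∈ Z, (z - a) ^ analyticOrderNatAt f a) := by
      fun_prop
    have hPb : (∏ a ∈ Z, (b - a) ^ analyticOrderNatAt f a) ≠ 0 :=
      Finset.prod_ne_zero_iff.2 fun a ha => pow_ne_zero _ (sub_ne_zero.2 fun h => hb (h ▸ ha))
    have hord : analyticOrderAt f b = analyticOrderAt g b := by
      have : f = (fun z => ∏ a ∈ Z, (z - a) ^ analyticOrderNatAt f a) • g := by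
        ext z; simp [hfg z]
      conv_lhs => rw [this]
      rw [analyticOrderAt_smul (hP.analyticAt b) (hg.analyticAt b),
        (hP.analyticAt b).analyticOrderAt_eq_zero.2 hPb, zero_add]
    have hordN : analyticOrderNatAt f b = analyticOrderNatAt g b := by
      simp only [analyticOrderNatAt, hord]
    obtain ⟨h, hh, hhb, hgh⟩ := exists_eq_pow_mul_of_analyticOrderAt_ne_top hg
      (hord ▸ analyticOrderAt_ne_top_of_differentiable hf h0 b)
    refine ⟨h, hh, fun a ha => ?_, fun z => ?_⟩
    · rcases Finset.mem_insert.1 ha with rfl | ha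
      · exact hhb
      · intro h0
        exact hgne a ha (by rw [hgh, h0, mul_zero])
    · rw [Finset.prod_insert hb, hfg z, hgh z, hordN]
      ring

theorem finite_zeros_of_isCompact {f : ℂ → ℂ} (hf : Differentiable ℂ f) (h0 : f 0 ≠ 0)
    {K : Set ℂ} (hK : IsCompact K) : {z ∈ K | f z = 0}.Finite := by
  by_contra h
  obtain ⟨x, -, hx⟩ := Set.Infinite.exists_accPt_of_subset_isCompact h hK (Set.sep_subset _ _)
  rw [accPt_iff_frequently_nhdsNE] at hx
  have := AnalyticOnNhd.eqOn_zero_of_preconnected_of_frequently_eq_zero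
    (f := f) (U := Set.univ) (fun z _ => hf.analyticAt z) isPreconnected_univ (Set.mem_univ x)
    (hx.mono fun _ h => h.2)
  exact h0 (this (Set.mem_univ 0))

theorem norm_deriv_div_le_of_ne_zero {G : ℂ → ℂ} (hG : Differentiable ℂ G) {T A : ℝ} (hT : 0 < T)
    (hA : 0 < A) (hne : ∀ z ∈ ball (0 : ℂ) (2 * T), G z ≠ 0)
    (hle : ∀ z ∈ ball (0 : ℂ) (2 * T), ‖G z‖ ≤ Real.exp A * ‖G 0‖) {z : ℂ} (hz : ‖z‖ ≤ T) :
    ‖deriv G z / G z‖ ≤ 12 * A / T := by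
  have hU : IsOpen (ball (0 : ℂ) (2 * T)) := isOpen_ball
  have hd : DifferentiableOn ℂ (fun z => deriv G z / G z) (ball 0 (2 * T)) :=
    (hG.deriv.differentiableOn).div hG.differentiableOn hne
  obtain ⟨h, hh0, hh⟩ := hd.isExactOn_ball.with_val_at 0 0
  have h0mem : (0 : ℂ) ∈ ball (0 : ℂ) (2 * T) := by simp; linarith
  have hexp : ∀ z ∈ ball (0 : ℂ) (2 * T), G z = G 0 * Complex.exp (h z) := by
    intro z hz
    have hder : ∀ w ∈ ball (0 : ℂ) (2 * T),
        HasDerivAt (fun w => G w * Complex.exp (-h w)) 0 w := by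
      intro w hw
      have := (hG w).hasDerivAt.mul ((hh w hw).neg.cexp)
      refine this.congr_deriv ?_
      have := hne w hw
      field_simp
      ring
    have := hU.is_const_of_deriv_eq_zero (convex_ball _ _).isPreconnected
      (fun w hw => (hder w hw).differentiableAt.differentiableWithinAt)
      (fun w hw => (hder w hw).deriv) hz h0mem
    simp only [hh0, neg_zero, Complex.exp_zero, mul_one] at this
    rw [← this, mul_assoc, ← Complex.exp_add]
    simp
  have hre : Set.MapsTo h (ball 0 (2 * T)) {z | z.re ≤ A} := by
    intro w hw
    have h1 := hle w hw
    rw [hexp w hw, norm_mul, mul_comm, Complex.norm_exp] at h1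
    have h2 := le_of_mul_le_mul_right h1 (norm_pos_iff.2 (hne 0 h0mem))
    exact Real.exp_le_exp.1 h2
  have hdh : DifferentiableOn ℂ h (ball 0 (2 * T)) :=
    fun w hw => (hh w hw).differentiableAt.differentiableWithinAt
  have hzm : z ∈ ball (0 : ℂ) (2 * T) := by simp; linarith
  have hsub : closedBall z (T / 2) ⊆ ball (0 : ℂ) (2 * T) := by
    intro w hw
    have : dist w 0 ≤ dist w z + dist z 0 := dist_triangle _ _ _
    rw [mem_closedBall] at hw
    rw [dist_zero_right z] at this
    rw [mem_ball]
    linarith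
  have := Complex.norm_deriv_le_of_forall_mem_sphere_norm_le (c := z) (R := T / 2) (C := 6 * A)
    (f := h) (by positivity) ((hdh.mono hsub).diffContOnCl_ball subset_rfl) (fun w hw => by
      have hw' := hsub (sphere_subset_closedBall hw)
      have hwn : ‖w‖ ≤ 3 / 2 * T := by
        have : dist w 0 ≤ dist w z + dist z 0 := dist_triangle _ _ _
        rw [mem_sphere] at hw
        rw [dist_zero_right, dist_zero_right] at this
        linarith
      refine (Complex.borelCaratheodory_zero hA hdh hre (by positivity) hw' hh0).trans ?_
      rw [div_le_iff₀ (by linarith)]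
      nlinarith)
  rw [(hh z hzm).deriv] at this
  refine this.trans (le_of_eq ?_)
  field_simp
  ring

section Core

variable {f : ℂ → ℂ} {T A : ℝ} {Z : Finset ℂ}

theorem exists_factor_norm_le (hf : Differentiable ℂ f) (h0 : f 0 ≠ 0) (hT : 0 < T)
    (hle : ∀ z, ‖z‖ ≤ 6 * T → ‖f z‖ ≤ Real.exp A * ‖f 0‖)
    (hZ : ∀ z, z ∈ Z ↔ ‖z‖ ≤ 2 * T ∧ f z = 0) :
    ∃ g : ℂ → ℂ, Differentiable ℂ g ∧ (∀ z, ‖z‖ ≤ 2 * T → g z ≠ 0) ∧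
      (∀ z, f z = (∏ a ∈ Z, (z - a) ^ analyticOrderNatAt f a) * g z) ∧
      ∀ z, ‖z‖ ≤ 6 * T →
        2 ^ (∑ a ∈ Z, analyticOrderNatAt f a) * ‖g z‖ ≤ Real.exp A * ‖g 0‖ := by
  obtain ⟨g, hg, hgZ, hfg⟩ := exists_eq_prod_pow_mul hf h0 Z
  set n := ∑ a ∈ Z, analyticOrderNatAt f a with hn
  refine ⟨g, hg, fun z hz h => ?_, hfg, fun z hz => ?_⟩
  · have hzZ : z ∈ Z := (hZ z).2 ⟨hz, by rw [hfg, h, mul_zero]⟩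
    exact hgZ z hzZ h
  have hf0 : ‖f 0‖ ≤ (2 * T) ^ n * ‖g 0‖ := by
    rw [hfg 0, norm_mul, norm_prod]
    gcongr
    rw [hn, ← Finset.prod_pow_eq_pow_sum]
    refine Finset.prod_le_prod (fun _ _ => norm_nonneg _) fun a ha => ?_
    rw [norm_pow, zero_sub, norm_neg]
    gcongr
    exact ((hZ a).1 ha).1
  have hfr : ∀ w ∈ frontier (ball (0 : ℂ) (6 * T)),
      ‖g w‖ ≤ Real.exp A * ‖f 0‖ / (4 * T) ^ n := by
    intro w hw
    rw [frontier_ball _ (by positivity), mem_sphere_zero_iff_norm] at hw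
    rw [le_div_iff₀ (by positivity)]
    refine le_trans ?_ (hle w hw.le)
    rw [hfg w, norm_mul, norm_prod, mul_comm]
    gcongr
    rw [hn, ← Finset.prod_pow_eq_pow_sum]
    refine Finset.prod_le_prod (fun _ _ => by positivity) fun a ha => ?_
    rw [norm_pow]
    gcongr
    have := norm_sub_norm_le w a
    linarith [((hZ a).1 ha).1]
  have hmax := Complex.norm_le_of_forall_mem_frontier_norm_le isBounded_ball
    (hg.diffContOnCl (s := ball (0 : ℂ) (6 * T))) hfr (z := z) (by
      rw [closure_ball _ (by positivity)]; simpa using hz)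
  rw [le_div_iff₀ (by positivity)] at hmax
  have h4 : (4 * T) ^ n = 2 ^ n * (2 * T) ^ n := by rw [← mul_pow]; ring_nf
  have hpos : 0 < (2 * T) ^ n := by positivity
  refine le_of_mul_le_mul_right ?_ hpos
  calc 2 ^ n * ‖g z‖ * (2 * T) ^ n = ‖g z‖ * (4 * T) ^ n := by rw [h4]; ring
    _ ≤ Real.exp A * ‖f 0‖ := hmax
    _ ≤ Real.exp A * ((2 * T) ^ n * ‖g 0‖) := by gcongr
    _ = Real.exp A * ‖g 0‖ * (2 * T) ^ n := by ring

/-- The number of zeros in a disk is controlled by the growth on a larger disk. -/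
theorem sum_analyticOrderNatAt_mul_log_two_le (hf : Differentiable ℂ f) (h0 : f 0 ≠ 0) (hT : 0 < T)
    (hle : ∀ z, ‖z‖ ≤ 6 * T → ‖f z‖ ≤ Real.exp A * ‖f 0‖)
    (hZ : ∀ z, z ∈ Z ↔ ‖z‖ ≤ 2 * T ∧ f z = 0) :
    ((∑ a ∈ Z, analyticOrderNatAt f a : ℕ) : ℝ) * Real.log 2 ≤ A := by
  obtain ⟨g, -, hg0, -, hgle⟩ := exists_factor_norm_le hf h0 hT hle hZ
  have h := hgle 0 (by simp; positivity)
  have h := le_of_mul_le_mul_right h (norm_pos_iff.2 (hg0 0 (by simp; positivity)))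
  have := Real.log_le_log (by positivity) h
  rwa [Real.log_pow, Real.log_exp] at this

/-- The logarithmic derivative is the sum of the polar parts at the nearby zeros, up to an error
controlled by the growth. -/
theorem norm_deriv_div_le_add_sum (hf : Differentiable ℂ f) (h0 : f 0 ≠ 0) (hT : 0 < T)
    (hA : 0 < A) (hle : ∀ z, ‖z‖ ≤ 6 * T → ‖f z‖ ≤ Real.exp A * ‖f 0‖)
    (hZ : ∀ z, z ∈ Z ↔ ‖z‖ ≤ 2 * T ∧ f z = 0) {z : ℂ} (hz : ‖z‖ ≤ T) (hfz : f z ≠ 0) :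
    ‖deriv f z / f z‖ ≤ 12 * A / T + ∑ a ∈ Z, analyticOrderNatAt f a / ‖z - a‖ := by
  obtain ⟨g, hg, hg0, hfg, hgle⟩ := exists_factor_norm_le hf h0 hT hle hZ
  have hgz : ‖deriv g z / g z‖ ≤ 12 * A / T := by
    refine norm_deriv_div_le_of_ne_zero hg hT hA (fun w hw => hg0 w ?_) (fun w hw => ?_) hz
    · exact (mem_ball_zero_iff.1 hw).le
    · have := mem_ball_zero_iff.1 hw
      refine le_trans ?_ (hgle w (by linarith))
      exact le_mul_of_one_le_left (norm_nonneg _) (one_le_pow₀ (by norm_num))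
  have hza : ∀ a ∈ Z, z - a ≠ 0 := fun a ha h => hfz (by
    rw [sub_eq_zero.1 h]; exact ((hZ a).1 ha).2)
  have hlog : deriv f z / f z =
      (∑ a ∈ Z, (analyticOrderNatAt f a : ℂ) / (z - a)) + deriv g z / g z := by
    have hfeq : f = fun z => (∏ a ∈ Z, (z - a) ^ analyticOrderNatAt f a) * g z := funext hfg
    rw [← logDeriv_apply, ← logDeriv_apply]
    conv_lhs => rw [hfeq]
    have hgz0 := hg0 z (by linarith)
    have hPz : (∏ a ∈ Z, (z - a) ^ analyticOrderNatAt f a) ≠ 0 :=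
      Finset.prod_ne_zero_iff.2 fun a ha => pow_ne_zero _ (hza a ha)
    have hPd : DifferentiableAt ℂ (fun z => ∏ a ∈ Z, (z - a) ^ analyticOrderNatAt f a) z := by
      fun_prop
    have hPlog : logDeriv (fun z => ∏ a ∈ Z, (z - a) ^ analyticOrderNatAt f a) z =
        ∑ a ∈ Z, logDeriv (fun z => (z - a) ^ analyticOrderNatAt f a) z := by
      have := logDeriv_prod (s := Z) (f := fun a z => (z - a) ^ analyticOrderNatAt f a) (x := z)
        (fun a ha => pow_ne_zero _ (hza a ha)) (fun a _ => by fun_prop)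
      simpa using this
    rw [logDeriv_mul z hPz hgz0 hPd (hg z), hPlog]
    congr 1
    refine Finset.sum_congr rfl fun a _ => ?_
    rw [logDeriv_fun_pow (by fun_prop), logDeriv_apply, deriv_sub_const, deriv_id'']
    ring
  rw [hlog, add_comm (12 * A / T)]
  refine (norm_add_le _ _).trans (add_le_add ((norm_sum_le _ _).trans ?_) hgz)
  simp

end Core

section Merge

theorem exists_dist_le_dist_le {E : Type*} [NormedAddCommGroup E] [NormedSpace ℝ E] {x y : E}
    {R R' : ℝ} (hR : 0 < R) (hR' : 0 < R') (h : dist x y ≤ R + R') :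
    ∃ c : E, dist x c ≤ R' ∧ dist y c ≤ R := by
  refine ⟨AffineMap.lineMap x y (R' / (R + R')), ?_, ?_⟩
  · rw [dist_left_lineMap, Real.norm_of_nonneg (by positivity), div_mul_eq_mul_div,
      div_le_iff₀ (by positivity)]
    gcongr
  · rw [dist_right_lineMap]
    have : 1 - R' / (R + R') = R / (R + R') := by field_simp; ring
    rw [this, Real.norm_of_nonneg (by positivity), div_mul_eq_mul_div, div_le_iff₀ (by positivity)]
    gcongr

variable {ι : Type*} {a : ι → ℂ} {r : ι → ℝ}

/-- Each class of balls of the partition `s` is contained in one ball whose radius is the sum of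
the radii of the class. -/
def IsEnclosable (a : ι → ℂ) (r : ι → ℝ) (s : Setoid ι) : Prop :=
  ∀ i, ∃ c, ∀ j, s j i → dist (a j) c + r j ≤ ∑' k, {k | s k i}.indicator r k

theorem isEnclosable_bot : IsEnclosable a r ⊥ := by
  intro i
  refine ⟨a i, fun j hj => ?_⟩
  obtain rfl : j = i := hj
  have : {k | (⊥ : Setoid ι) k j} = {j} := rfl
  rw [this, ← tsum_subtype, tsum_singleton]
  simp

theorem exists_isEnclosable_upperBound (hr : ∀ i, 0 < r i) (hs : Summable r) {C : Set (Setoid ι)}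
    (hC : ∀ s ∈ C, IsEnclosable a r s) (hchain : IsChain (· ≤ ·) C) (hne : C.Nonempty) :
    ∃ u, IsEnclosable a r u ∧ ∀ s ∈ C, s ≤ u := by
  obtain ⟨s₀, hs₀⟩ := hne
  let u : Setoid ι :=
    { r := fun i j => ∃ s ∈ C, s i j
      iseqv :=
        ⟨fun i => ⟨s₀, hs₀, s₀.refl i⟩, fun ⟨s, hs, h⟩ => ⟨s, hs, s.symm h⟩, by
          rintro i j k ⟨s, hs, h⟩ ⟨s', hs', h'⟩
          rcases hchain.total hs hs' with hle | hle
          · exact ⟨s', hs', s'.trans (hle h) h'⟩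
          · exact ⟨s, hs, s.trans h (hle h')⟩⟩ }
  have hle : ∀ s ∈ C, s ≤ u := fun s hs i j h => ⟨s, hs, h⟩
  refine ⟨u, fun i => ?_, hle⟩
  set S := ∑' k, {k | u k i}.indicator r k
  have hfin : ∀ t : Finset {j // u j i}, ∃ s ∈ C, ∀ j ∈ t, s j.1 i := by
    classical
    intro t
    induction t using Finset.induction_on with
    | empty => exact ⟨s₀, hs₀, by simp⟩
    | insert j t _ ih =>
      obtain ⟨s, hs, h⟩ := ih
      obtain ⟨s', hs', h'⟩ := j.2
      rcases hchain.total hs hs' with hle | hle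
      · exact ⟨s', hs', fun k hk => (Finset.mem_insert.1 hk).elim (fun e => e ▸ h')
          fun hk => hle (h k hk)⟩
      · exact ⟨s, hs, fun k hk => (Finset.mem_insert.1 hk).elim (fun e => e ▸ hle h')
          fun hk => h k hk⟩
  have key : (closedBall (a i) S ∩ ⋂ j : {j // u j i}, {c | dist (a j.1) c + r j.1 ≤ S}).Nonempty := by
    refine (isCompact_closedBall _ _).inter_iInter_nonempty _
      (fun j => isClosed_le (by fun_prop) (by fun_prop)) fun t => ?_
    obtain ⟨s, hsC, hst⟩ := hfin t
    obtain ⟨c, hc⟩ := hC s hsC i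
    have hSle : ∑' k, {k | s k i}.indicator r k ≤ S :=
      Summable.tsum_le_tsum (fun k => Set.indicator_le_indicator_of_subset
        (fun k hk => hle s hsC hk) (fun k => (hr k).le) k) (hs.indicator _) (hs.indicator _)
    refine ⟨c, ?_, ?_⟩
    · rw [mem_closedBall, dist_comm]
      linarith [hc i (s.refl i), hr i]
    · simp only [Set.mem_iInter]
      exact fun j hj => (hc j.1 (hst j hj)).trans hSle
  obtain ⟨c, -, hc⟩ := key
  exact ⟨c, fun j hj => Set.mem_iInter.1 hc ⟨j, hj⟩⟩

theorem tsum_indicator_class_pos (hr : ∀ i, 0 < r i) (hs : Summable r) (s : Setoid ι) (i : ι) :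
    0 < ∑' k, {k | s k i}.indicator r k :=
  (hs.indicator _).tsum_pos (Set.indicator_nonneg fun k _ => (hr k).le) i (by
    rw [Set.indicator_of_mem (show i ∈ {k | s k i} from s.refl i)]; exact hr i)

/-- Any family of disks with summable radii can be merged into pairwise disjoint disks, where the
radius of each new disk is the sum of the radii of the old disks it replaces. -/
theorem exists_pairwise_disjoint_merge (hr : ∀ i, 0 < r i) (hs : Summable r) :
    ∃ (s : Setoid ι) (c : Quotient s → ℂ),
      (∀ i, closedBall (a i) (r i) ⊆ closedBall (c (Quotient.mk s i))
        (∑' k, {k | Quotient.mk s k = Quotient.mk s i}.indicator r k)) ∧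
      Pairwise fun q q' => Disjoint
        (closedBall (c q) (∑' k, {k | Quotient.mk s k = q}.indicator r k))
        (closedBall (c q') (∑' k, {k | Quotient.mk s k = q'}.indicator r k)) := by
  classical
  obtain ⟨s, -, hmax⟩ := zorn_le_nonempty₀ {s | IsEnclosable a r s}
    (fun C hC hchain y hy => exists_isEnclosable_upperBound hr hs hC hchain ⟨y, hy⟩) ⊥
    isEnclosable_bot
  have hP : IsEnclosable a r s := hmax.prop
  choose c hc using hP
  have hclass : ∀ q : Quotient s, {k | Quotient.mk s k = q} = {k | s k q.out} := by
    intro q; ext k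
    rw [Set.mem_ofPred_eq, Set.mem_ofPred_eq, ← Quotient.eq (r := s), Quotient.out_eq]
  refine ⟨s, fun q => c q.out, fun i => ?_, fun q q' hqq' => ?_⟩
  · rw [hclass]
    refine closedBall_subset_closedBall' ?_
    rw [add_comm]
    exact hc _ i (s.symm (Quotient.mk_out i))
  · beta_reduce
    rw [hclass, hclass]
    set i := q.out
    set j := q'.out
    have hij : ¬ s i j := fun h => hqq' (by
      rw [← Quotient.out_eq q, ← Quotient.out_eq q']; exact Quotient.sound h)
    by_contra hdis
    obtain ⟨p, hp, hp'⟩ := Set.not_disjoint_iff.1 hdis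
    have hRi := tsum_indicator_class_pos hr hs s i
    have hRj := tsum_indicator_class_pos hr hs s j
    have hdist : dist (c i) (c j) ≤ ∑' k, {k | s k i}.indicator r k +
        ∑' k, {k | s k j}.indicator r k := by
      have := dist_triangle_left (c i) (c j) p
      rw [mem_closedBall] at hp hp'
      linarith
    obtain ⟨e, hei, hej⟩ := exists_dist_le_dist_le hRi hRj hdist
    let φ : ι → Quotient s := fun k => if s k j then Quotient.mk s i else Quotient.mk s k
    have hφi : ∀ k, φ k = Quotient.mk s i ↔ s k i ∨ s k j := by
      intro k
      by_cases hk : s k j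
      · simp [φ, hk]
      · simp only [φ, hk, if_false, or_false]
        exact Quotient.eq
    have hP' : IsEnclosable a r (Setoid.ker φ) := by
      intro k
      by_cases hk : φ k = Quotient.mk s i
      · have hset : {l | Setoid.ker φ l k} = {l | s l i} ∪ {l | s l j} := by
          ext l
          rw [Set.mem_ofPred_eq, Setoid.ker_def, hk, hφi]
          rfl
        have hdisj : Disjoint {l | s l i} {l | s l j} :=
          Set.disjoint_left.2 fun l hl hl' => hij (s.trans (s.symm hl) hl')
        refine ⟨e, fun l hl => ?_⟩
        rw [hset, Set.indicator_union_of_disjoint hdisj,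
          (hs.indicator _).tsum_add (hs.indicator _)]
        rw [Setoid.ker_def, hk, hφi] at hl
        rcases hl with hl | hl
        · linarith [hc i l hl, dist_triangle (a l) (c i) e]
        · linarith [hc j l hl, dist_triangle (a l) (c j) e]
      · have hcls : ∀ l, Setoid.ker φ l k ↔ s l k := by
          intro l
          rw [Setoid.ker_def]
          have hk' := hk
          rw [hφi, not_or] at hk'
          constructor
          · intro h
            have hl := hk
            rw [← h, hφi, not_or] at hl
            simp only [φ, hk'.2, hl.2, if_false] at h
            exact Quotient.exact h
          · intro h
            have hlj : ¬ s l j := fun h' => hk'.2 (s.trans (s.symm h) h')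
            simp only [φ, hk'.2, hlj, if_false]
            exact Quotient.sound h
        refine ⟨c k, fun l hl => ?_⟩
        simp only [hcls]
        exact hc k l ((hcls l).1 hl)
    have hle : s ≤ Setoid.ker φ := by
      intro k l h
      have : s k j ↔ s l j := ⟨fun h' => s.trans (s.symm h) h', fun h' => s.trans h h'⟩
      simp only [Setoid.ker_def, φ, this]
      rw [Quotient.sound h]
    exact hij (hmax.le_of_ge hP' hle (by
      rw [Setoid.ker_def, (hφi i).2 (Or.inl (s.refl i)), (hφi j).2 (Or.inr (s.refl j))]))

theorem exists_seq_pairwise_disjoint_merge [Countable ι] (hr : ∀ i, 0 < r i) (hs : Summable r)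
    (hunb : ∀ B : ℝ, ∃ i, B < ‖a i‖) :
    ∃ (b : ℕ → ℂ) (R : ℕ → ℝ), (∀ k, 0 < R k) ∧ Tendsto R atTop (nhds 0) ∧
      (∀ k l, k ≠ l → Disjoint (closedBall (b k) (R k)) (closedBall (b l) (R l))) ∧
      ∀ i, ∃ k, closedBall (a i) (r i) ⊆ closedBall (b k) (R k) := by
  obtain ⟨s, c, hsub, hdisj⟩ := exists_pairwise_disjoint_merge (a := a) hr hs
  set S : Quotient s → ℝ := fun q => ∑' k, {k | Quotient.mk s k = q}.indicator r k with hS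
  have hSpos : ∀ q, 0 < S q := by
    intro q
    induction q using Quotient.inductionOn with
    | h i =>
      simp only [hS, Quotient.eq]
      exact tsum_indicator_class_pos hr hs s i
  have hSsum : Summable S := by
    have := (hs.hasSum.tsum_fiberwise (Quotient.mk s)).summable
    refine this.congr fun q => ?_
    rw [tsum_subtype]
    rfl
  have hinf : Infinite (Quotient s) := by
    by_contra hfin
    rw [not_infinite_iff_finite] at hfin
    have hbdd : Bornology.IsBounded (⋃ q, closedBall (c q) (S q)) :=
      Bornology.isBounded_iUnion.2 fun q => isBounded_closedBall
    obtain ⟨B, hB⟩ := hbdd.exists_norm_le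
    obtain ⟨i, hi⟩ := hunb B
    exact hi.not_ge (hB _ (Set.mem_iUnion.2 ⟨_, hsub i (mem_closedBall_self (hr i).le)⟩))
  obtain ⟨e⟩ := nonempty_equiv_of_countable (α := ℕ) (β := Quotient s)
  refine ⟨c ∘ e, S ∘ e, fun k => hSpos _, ?_, fun k l hkl => hdisj (e.injective.ne hkl),
    fun i => ⟨e.symm (Quotient.mk s i), ?_⟩⟩
  · exact ((e.summable_iff).2 hSsum).tendsto_atTop_zero
  · simp only [Function.comp, Equiv.apply_symm_apply]
    exact hsub i

end Merge

/-- The points around which a finite mass is concentrated at some scale are covered by disks with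
summable radii. -/
theorem exists_cover_of_lt_tsum_indicator {w : ℂ → ℝ} (hw : ∀ a, 0 ≤ w a) (hs : Summable w) :
    ∃ u : Set (ℂ × ℝ), u.Countable ∧ (∀ p ∈ u, 0 < p.2) ∧ Summable (fun p : u => p.1.2) ∧
      ∀ z t, 0 < t → t < ∑' a, (closedBall z t).indicator w a →
        ∃ p ∈ u, z ∈ closedBall p.1 (5 * p.2) := by
  obtain ⟨u, hut, hdisj, hcov⟩ := Vitali.exists_disjoint_subfamily_covering_enlargement_closedBall
    {p : ℂ × ℝ | 0 < p.2 ∧ p.2 < ∑' a, (closedBall p.1 p.2).indicator w a} Prod.fst Prod.snd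
    (∑' a, w a) (fun p hp => hp.2.le.trans (Summable.tsum_le_tsum
      (fun a => Set.indicator_le_self' (fun a _ => hw a) a) (hs.indicator _) hs)) 5 (by norm_num)
  have hpos : ∀ p ∈ u, 0 < p.2 := fun p hp => (hut hp).1
  have hsum : Summable (fun p : u => p.1.2) := by
    refine summable_of_sum_le (c := ∑' a, w a) (fun p => (hpos p.1 p.2).le) fun F => ?_
    calc ∑ p ∈ F, p.1.2
        ≤ ∑ p ∈ F, ∑' a, (closedBall p.1.1 p.1.2).indicator w a :=
          Finset.sum_le_sum fun p _ => (hut p.2).2.le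
      _ = ∑' a, ∑ p ∈ F, (closedBall p.1.1 p.1.2).indicator w a :=
          (Summable.tsum_finsetSum fun p _ => hs.indicator _).symm
      _ ≤ ∑' a, w a := by
          refine Summable.tsum_le_tsum (fun a => ?_) (summable_sum fun p _ => hs.indicator _) hs
          have := Finset.indicator_biUnion_apply F
            (fun p : u => closedBall p.1.1 p.1.2) (f := w) (fun p _ q _ hpq =>
              hdisj p.2 q.2 (Subtype.coe_injective.ne hpq)) a
          rw [← this]
          exact Set.indicator_le_self' (fun a _ => hw a) a
  refine ⟨u, ?_, hpos, hsum, fun z t ht hlt => ?_⟩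
  · have := hsum.countable_support
    rw [Function.support_eq_univ (fun p : u => (hpos p.1 p.2).ne')] at this
    exact Set.countable_coe_iff.1 (Set.countable_univ_iff.1 this)
  · obtain ⟨p, hp, hsub⟩ := hcov (z, t) ⟨ht, hlt⟩
    exact ⟨p, hp, hsub (mem_closedBall_self ht.le)⟩

theorem harmonic_add_div_le (n m : ℕ) :
    (harmonic n : ℝ) + m / (n + m : ℕ) ≤ harmonic (n + m) := by
  have hadd : (harmonic (n + m) : ℝ) =
      harmonic n + ∑ i ∈ Finset.range m, ((n + i + 1 : ℕ) : ℝ)⁻¹ := by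
    simp [harmonic, Finset.sum_range_add]
  rw [hadd]
  gcongr
  calc (m : ℝ) / (n + m : ℕ) = ∑ i ∈ Finset.range m, ((n + m : ℕ) : ℝ)⁻¹ := by
        rw [Finset.sum_const, Finset.card_range, nsmul_eq_mul]; rfl
    _ ≤ _ := by
        refine Finset.sum_le_sum fun i hi => ?_
        push_cast
        have : (i : ℝ) + 1 ≤ m := by exact_mod_cast Finset.mem_range.1 hi
        gcongr ?_⁻¹
        linarith

/-- If at most `K * t` of the weighted points lie within distance `t`, the sum of the inverse
distances is at most `K` times a harmonic number. -/
theorem sum_div_le_mul_harmonic {α : Type*} {Z : Finset α} {m : α → ℕ} {d : α → ℝ} {K : ℝ}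
    (hd : ∀ x ∈ Z, 0 < d x)
    (h : ∀ x ∈ Z, ((∑ y ∈ Z with d y ≤ d x, m y : ℕ) : ℝ) ≤ K * d x) :
    ∑ x ∈ Z, m x / d x ≤ K * harmonic (∑ x ∈ Z, m x) := by
  classical
  induction Z using Finset.induction_on_max_value d with
  | empty => simp
  | insert x Z hx hmax ih =>
    have hx0 := hd x (Finset.mem_insert_self _ _)
    have hx1 := h x (Finset.mem_insert_self _ _)
    rw [Finset.filter_true_of_mem (fun y hy => (Finset.mem_insert.1 hy).elim (fun e => e ▸ le_rfl)
      (hmax y)), Finset.sum_insert hx] at hx1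
    have hK : 0 ≤ K := nonneg_of_mul_nonneg_left ((Nat.cast_nonneg _).trans hx1) hx0
    have ih' := ih (fun y hy => hd y (Finset.mem_insert_of_mem hy)) fun y hy => by
      refine le_trans ?_ (h y (Finset.mem_insert_of_mem hy))
      exact_mod_cast Finset.sum_le_sum_of_subset
        (Finset.filter_subset_filter _ (Finset.subset_insert _ _))
    rw [Finset.sum_insert hx, Finset.sum_insert hx]
    have hH := harmonic_add_div_le (∑ y ∈ Z, m y) (m x)
    rw [add_comm (∑ y ∈ Z, m y)] at hH
    have hquot : (m x : ℝ) / d x ≤ K * (m x / (m x + ∑ y ∈ Z, m y : ℕ)) := by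
      rcases Nat.eq_zero_or_pos (m x) with h0 | h0
      · simp [h0]
      · have hM : (0 : ℝ) < (m x + ∑ y ∈ Z, m y : ℕ) := by exact_mod_cast Nat.add_pos_left h0 _
        rw [← mul_div_assoc, div_le_div_iff₀ hx0 hM]
        have : (0 : ℝ) ≤ m x := Nat.cast_nonneg _
        nlinarith
    calc _ ≤ K * (m x / (m x + ∑ y ∈ Z, m y : ℕ)) + K * harmonic (∑ y ∈ Z, m y) :=
          add_le_add hquot ih'
      _ = K * (harmonic (∑ y ∈ Z, m y) + m x / (m x + ∑ y ∈ Z, m y : ℕ)) := by ring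
      _ ≤ _ := by gcongr

section Growth

variable {f : ℂ → ℂ} {c ρ : ℝ}

theorem norm_le_exp_of_growth (hc : 0 ≤ c) (hρ : 0 ≤ ρ)
    (hgrowth : ∀ z, ‖f z‖ ≤ Real.exp (c * (1 + ‖z‖) ^ ρ) * ‖f 0‖) {T : ℝ} (hT : 1 ≤ T) {z : ℂ}
    (hz : ‖z‖ ≤ 6 * T) : ‖f z‖ ≤ Real.exp (c * 7 ^ ρ * T ^ ρ) * ‖f 0‖ := by
  refine (hgrowth z).trans ?_
  rw [mul_assoc c, ← Real.mul_rpow (by norm_num) (by linarith)]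
  gcongr
  linarith

/-- The number of zeros in a disk of radius `2 * T` is `O(T ^ ρ)`. -/
theorem sum_analyticOrderNatAt_le (hf : Differentiable ℂ f) (h0 : f 0 ≠ 0) (hc : 0 ≤ c)
    (hρ : 0 ≤ ρ) (hgrowth : ∀ z, ‖f z‖ ≤ Real.exp (c * (1 + ‖z‖) ^ ρ) * ‖f 0‖) {T : ℝ} (hT : 1 ≤ T)
    {Z : Finset ℂ} (hZ : ∀ z, z ∈ Z ↔ ‖z‖ ≤ 2 * T ∧ f z = 0) :
    ((∑ a ∈ Z, analyticOrderNatAt f a : ℕ) : ℝ) ≤ 2 * c * 7 ^ ρ * T ^ ρ := by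
  have h := sum_analyticOrderNatAt_mul_log_two_le hf h0 (by linarith)
    (fun z hz => norm_le_exp_of_growth hc hρ hgrowth hT hz) hZ
  have hlog := Real.log_two_gt_d9
  have hn : (0 : ℝ) ≤ (∑ a ∈ Z, analyticOrderNatAt f a : ℕ) := Nat.cast_nonneg _
  nlinarith

theorem exists_finset_zeros (hf : Differentiable ℂ f) (h0 : f 0 ≠ 0) (R : ℝ) :
    ∃ Z : Finset ℂ, ∀ z, z ∈ Z ↔ ‖z‖ ≤ R ∧ f z = 0 :=
  ⟨(finite_zeros_of_isCompact hf h0 (isCompact_closedBall 0 R)).toFinset, fun z => by simp⟩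

/-- The zeros can be given summable weights comparable with `(1 + ‖a‖) ^ (-(ρ + 1))`. -/
theorem exists_summable_weight (hf : Differentiable ℂ f) (h0 : f 0 ≠ 0) (hc : 0 ≤ c)
    (hρ : 0 ≤ ρ) (hgrowth : ∀ z, ‖f z‖ ≤ Real.exp (c * (1 + ‖z‖) ^ ρ) * ‖f 0‖) :
    ∃ w : ℂ → ℝ, (∀ a, 0 ≤ w a) ∧ Summable w ∧
      ∀ a, analyticOrderNatAt f a ≤ (1 + ‖a‖) ^ (ρ + 1) * w a := by
  classical
  choose κ hκ hκ' using fun a : ℂ =>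
    exists_nat_pow_near (x := 1 + ‖a‖) (y := 2) (by simp) (by norm_num)
  have hpos : ∀ k : ℕ, (0 : ℝ) < 2 ^ k := fun k => by positivity
  refine ⟨fun a => analyticOrderNatAt f a * ((2 : ℝ) ^ κ a) ^ (-(ρ + 1)), fun a => by positivity,
    summable_of_sum_le (c := 2 * c * 7 ^ ρ * 2) (fun a => by positivity) fun F => ?_, fun a => ?_⟩
  · rw [← Finset.sum_fiberwise_of_maps_to (t := F.image κ) (g := κ)
      (fun a ha => Finset.mem_image_of_mem _ ha)]
    calc _ ≤ ∑ k ∈ F.image κ, 2 * c * 7 ^ ρ * (1 / 2) ^ k := Finset.sum_le_sum fun k _ => ?_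
      _ = 2 * c * 7 ^ ρ * ∑ k ∈ F.image κ, (1 / 2) ^ k := by rw [Finset.mul_sum]
      _ ≤ 2 * c * 7 ^ ρ * 2 := by
        gcongr
        exact (summable_geometric_two.sum_le_tsum _ fun k _ => by positivity).trans
          tsum_geometric_two.le
    obtain ⟨Z, hZ⟩ := exists_finset_zeros hf h0 (2 * 2 ^ k)
    have hle : ((∑ a ∈ F with κ a = k, analyticOrderNatAt f a : ℕ) : ℝ) ≤
        2 * c * 7 ^ ρ * (2 ^ k) ^ ρ := by
      refine le_trans ?_ (sum_analyticOrderNatAt_le hf h0 hc hρ hgrowth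
        (one_le_pow₀ (by norm_num)) hZ)
      norm_cast
      refine Finset.sum_le_sum_of_ne_zero fun a ha hane => (hZ a).2 ⟨?_, ?_⟩
      · have := hκ' a
        rw [(Finset.mem_filter.1 ha).2, pow_succ] at this
        linarith
      · exact apply_eq_zero_of_analyticOrderNatAt_ne_zero hane
    calc ∑ a ∈ F with κ a = k, analyticOrderNatAt f a * ((2 : ℝ) ^ κ a) ^ (-(ρ + 1))
        = (∑ a ∈ F with κ a = k, analyticOrderNatAt f a : ℕ) * ((2 : ℝ) ^ k) ^ (-(ρ + 1)) := by
          rw [Nat.cast_sum, Finset.sum_mul]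
          refine Finset.sum_congr rfl fun a ha => ?_
          rw [(Finset.mem_filter.1 ha).2]
      _ ≤ 2 * c * 7 ^ ρ * (2 ^ k) ^ ρ * ((2 : ℝ) ^ k) ^ (-(ρ + 1)) := by gcongr
      _ = 2 * c * 7 ^ ρ * (1 / 2) ^ k := by
          rw [mul_assoc (2 * c * 7 ^ ρ), ← Real.rpow_add (hpos k), neg_add, add_neg_cancel_left,
            Real.rpow_neg_one, one_div, inv_pow]
  · have h1 : ((2 : ℝ) ^ κ a) ^ (ρ + 1) * ((2 : ℝ) ^ κ a) ^ (-(ρ + 1)) = 1 := by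
      rw [← Real.rpow_add (hpos _), add_neg_cancel, Real.rpow_zero]
    calc (analyticOrderNatAt f a : ℝ)
        = ((2 : ℝ) ^ κ a) ^ (ρ + 1) *
          (analyticOrderNatAt f a * ((2 : ℝ) ^ κ a) ^ (-(ρ + 1))) := by
          rw [mul_left_comm, h1, mul_one]
      _ ≤ _ := by
          gcongr
          exact hκ a

theorem exists_disks_norm_deriv_div_le (hf : Differentiable ℂ f) (h0 : f 0 ≠ 0) (hc : 1 ≤ c)
    (hρ : 0 ≤ ρ) (hgrowth : ∀ z, ‖f z‖ ≤ Real.exp (c * (1 + ‖z‖) ^ ρ) * ‖f 0‖) :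
    ∃ (C : ℝ) (u : Set (ℂ × ℝ)), 0 < C ∧ u.Countable ∧ (∀ p ∈ u, 0 < p.2) ∧
      Summable (fun p : u => p.1.2) ∧
      (∀ z, f z = 0 → ∃ p ∈ u, z ∈ closedBall p.1 p.2) ∧
      ∀ z, (∀ p ∈ u, z ∉ closedBall p.1 p.2) →
        ‖deriv f z / f z‖ ≤ C * (1 + ‖z‖) ^ (ρ + 2) := by
  have hc0 : 0 ≤ c := by linarith
  obtain ⟨w, hw, hws, hmw⟩ := exists_summable_weight hf h0 hc0 hρ hgrowth
  obtain ⟨u, huc, hupos, husum, hcov⟩ := exists_cover_of_lt_tsum_indicator hw hws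
  have hzero : ∀ z, f z = 0 → ∃ p ∈ u, z ∈ closedBall p.1 (5 * p.2) := by
    intro z hz
    have hm : analyticOrderNatAt f z ≠ 0 := by
      intro h
      have := Nat.cast_analyticOrderNatAt (analyticOrderAt_ne_top_of_differentiable hf h0 z)
      rw [h, Nat.cast_zero] at this
      exact (hf.analyticAt z).analyticOrderAt_eq_zero.1 this.symm hz
    have hwz : 0 < w z := by
      have h1 : (0 : ℝ) < analyticOrderNatAt f z := by exact_mod_cast Nat.pos_of_ne_zero hm
      exact pos_of_mul_pos_right (h1.trans_le (hmw z)) (by positivity)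
    refine hcov z (w z / 2) (by positivity) ?_
    have := (hws.indicator (closedBall z (w z / 2))).le_tsum z
      (fun a _ => Set.indicator_nonneg (fun a _ => hw a) a)
    rw [Set.indicator_of_mem (mem_closedBall_self (by positivity))] at this
    linarith
  set D := 2 * c * (7 : ℝ) ^ ρ with hD
  have h7 : (1 : ℝ) ≤ 7 ^ ρ := Real.one_le_rpow (by norm_num) hρ
  have hD1 : 1 ≤ D := by nlinarith
  have hlogD : 0 ≤ Real.log D := Real.log_nonneg hD1
  refine ⟨6 * D + 3 ^ (ρ + 1) * (1 + Real.log D + ρ),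
    (fun p : ℂ × ℝ => (p.1, 5 * p.2)) '' u, by positivity, huc.image _, ?_, ?_, ?_, fun z hz => ?_⟩
  · rintro _ ⟨p, hp, rfl⟩
    have := hupos p hp
    positivity
  · have hinj : Set.InjOn (fun p : ℂ × ℝ => (p.1, 5 * p.2)) u := by
      rintro ⟨a, s⟩ - ⟨b, t⟩ - h
      simpa using h
    rw [← (Equiv.Set.imageOfInjOn _ u hinj).summable_iff]
    exact husum.mul_left 5
  · intro z hz
    obtain ⟨p, hp, h⟩ := hzero z hz
    exact ⟨_, ⟨p, hp, rfl⟩, h⟩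
  have hz' : ∀ p ∈ u, z ∉ closedBall p.1 (5 * p.2) := fun p hp => hz _ ⟨p, hp, rfl⟩
  have hfz : f z ≠ 0 := fun h => by
    obtain ⟨p, hp, h⟩ := hzero z h
    exact hz' p hp h
  have hmass : ∀ t, 0 < t → ∑' a, (closedBall z t).indicator w a ≤ t := by
    intro t ht
    by_contra! hlt
    obtain ⟨p, hp, h⟩ := hcov z t ht hlt
    exact hz' p hp h
  set T := 1 + ‖z‖ with hTdef
  have hT : 1 ≤ T := by simp [hTdef]
  have hT0 : 0 < T := by linarith
  obtain ⟨Z, hZ⟩ := exists_finset_zeros hf h0 (2 * T)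
  have hA : 0 < c * 7 ^ ρ * T ^ ρ := by positivity
  have hmain := norm_deriv_div_le_add_sum hf h0 hT0 hA
    (fun z hz => norm_le_exp_of_growth hc0 hρ hgrowth hT hz) hZ (z := z) (by simp [hTdef]) hfz
  have hcount := sum_analyticOrderNatAt_le hf h0 hc0 hρ hgrowth hT hZ
  rw [← hD] at hcount
  have hdpos : ∀ a ∈ Z, 0 < ‖z - a‖ := fun a ha => norm_pos_iff.2 (sub_ne_zero.2 fun h =>
    hfz (h ▸ ((hZ a).1 ha).2))
  have hsum := sum_div_le_mul_harmonic (m := analyticOrderNatAt f) (d := fun a => ‖z - a‖)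
    (K := (3 * T) ^ (ρ + 1)) hdpos fun a ha => by
      calc ((∑ b ∈ Z with ‖z - b‖ ≤ ‖z - a‖, analyticOrderNatAt f b : ℕ) : ℝ)
          ≤ ∑ b ∈ Z with ‖z - b‖ ≤ ‖z - a‖,
              (3 * T) ^ (ρ + 1) * (closedBall z ‖z - a‖).indicator w b := by
            rw [Nat.cast_sum]
            refine Finset.sum_le_sum fun b hb => (hmw b).trans ?_
            obtain ⟨hbZ, hb⟩ := Finset.mem_filter.1 hb
            rw [Set.indicator_of_mem (by rwa [mem_closedBall, dist_comm, dist_eq_norm])]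
            have := hw b
            have := ((hZ b).1 hbZ).1
            gcongr
            linarith
        _ ≤ (3 * T) ^ (ρ + 1) * ∑' b, (closedBall z ‖z - a‖).indicator w b := by
            rw [← Finset.mul_sum]
            gcongr
            exact (hws.indicator _).sum_le_tsum _
              fun b _ => Set.indicator_nonneg (fun b _ => hw b) b
        _ ≤ _ := by
            gcongr
            exact hmass _ (hdpos a ha)
  have hharm : (harmonic (∑ a ∈ Z, analyticOrderNatAt f a) : ℝ) ≤ (1 + Real.log D + ρ) * T := by
    refine (harmonic_le_one_add_log _).trans ?_
    have hTρ : 1 ≤ T ^ ρ := Real.one_le_rpow hT hρ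
    have hlog : Real.log ((∑ a ∈ Z, analyticOrderNatAt f a : ℕ) : ℝ) ≤ Real.log D + ρ * T := by
      rcases Nat.eq_zero_or_pos (∑ a ∈ Z, analyticOrderNatAt f a) with h | h
      · rw [h, Nat.cast_zero, Real.log_zero]
        positivity
      · refine (Real.log_le_log (by exact_mod_cast h) hcount).trans ?_
        rw [Real.log_mul (by positivity) (by positivity), Real.log_rpow hT0]
        gcongr
        exact (Real.log_le_sub_one_of_pos hT0).trans (by linarith)
    nlinarith
  calc ‖deriv f z / f z‖
      ≤ 12 * (c * 7 ^ ρ * T ^ ρ) / T + (3 * T) ^ (ρ + 1) * ((1 + Real.log D + ρ) * T) := by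
        refine hmain.trans (add_le_add le_rfl (hsum.trans ?_))
        gcongr
    _ ≤ 6 * D * T ^ (ρ + 2) + 3 ^ (ρ + 1) * (1 + Real.log D + ρ) * T ^ (ρ + 2) := by
        refine add_le_add ?_ (le_of_eq ?_)
        · calc 12 * (c * 7 ^ ρ * T ^ ρ) / T ≤ 12 * (c * 7 ^ ρ * T ^ ρ) :=
                div_le_self (by positivity) hT
            _ = 6 * D * T ^ ρ := by rw [hD]; ring
            _ ≤ 6 * D * T ^ (ρ + 2) := by
                gcongr
                linarith
        · have : T ^ (ρ + 2) = T ^ (ρ + 1) * T := by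
            rw [← Real.rpow_add_one hT0.ne']
            ring_nf
          rw [Real.mul_rpow (by norm_num) hT0.le, this]
          ring
    _ = _ := by ring

end Growth

theorem exists_growth_of_norm_le {f : ℂ → ℂ} {ρ C : ℝ} (hρ : 0 ≤ ρ) (hC : 0 < C)
    (hbound : ∀ z : ℂ, ‖f z‖ ≤ C * Real.exp (‖z‖ ^ ρ)) {p : ℂ} (hp : f p ≠ 0) :
    ∃ c, 1 ≤ c ∧ ∀ z, ‖f (z + p)‖ ≤ Real.exp (c * (1 + ‖z‖) ^ ρ) * ‖f p‖ := by
  have hfp : 0 < ‖f p‖ := norm_pos_iff.2 hp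
  have h1p : 1 ≤ (1 + ‖p‖) ^ ρ := Real.one_le_rpow (by simp) hρ
  refine ⟨|Real.log (C / ‖f p‖)| + (1 + ‖p‖) ^ ρ,
    by linarith [abs_nonneg (Real.log (C / ‖f p‖))], fun z => (hbound _).trans ?_⟩
  have hz1 : 1 ≤ (1 + ‖z‖) ^ ρ := Real.one_le_rpow (by simp) hρ
  have hpow : ‖z + p‖ ^ ρ ≤ (1 + ‖p‖) ^ ρ * (1 + ‖z‖) ^ ρ := by
    rw [← Real.mul_rpow (by positivity) (by positivity)]
    gcongr
    nlinarith [norm_add_le z p, norm_nonneg z, norm_nonneg p]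
  have hlog : Real.log (C / ‖f p‖) ≤ |Real.log (C / ‖f p‖)| * (1 + ‖z‖) ^ ρ :=
    (le_abs_self _).trans (le_mul_of_one_le_right (abs_nonneg _) hz1)
  have hCe : C = Real.exp (Real.log (C / ‖f p‖)) * ‖f p‖ := by
    rw [Real.exp_log (by positivity)]
    field_simp
  calc C * Real.exp (‖z + p‖ ^ ρ)
      = Real.exp (Real.log (C / ‖f p‖) + ‖z + p‖ ^ ρ) * ‖f p‖ := by
        rw [Real.exp_add]
        nth_rewrite 1 [hCe]
        ring
    _ ≤ _ := by
        gcongr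
        linarith

/-- The logarithmic derivative `f'/f` of a nonzero entire function `f` of finite order
`ρ` is essentially of moderate growth with growth exponent `N ≥ ρ + 2`: outside a
union of pairwise disjoint closed disks with radii tending to zero which contain all
the zeros of `f`, one has `|f'(z)/f(z)| ≤ C'·|z|^N`. -/
theorem logDeriv_essentially_moderate_growth
    (f : ℂ → ℂ) (hf : Differentiable ℂ f) (hfne : ∃ z : ℂ, f z ≠ 0)
    (ρ C : ℝ) (hρ : 0 ≤ ρ) (hC : 0 < C)
    (hbound : ∀ z : ℂ, ‖f z‖ ≤ C * Real.exp (‖z‖ ^ ρ))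
    (N : ℕ) (hN : ρ + 2 ≤ (N : ℝ)) :
    ∃ (C' : ℝ) (a : ℕ → ℂ) (r : ℕ → ℝ), 0 < C' ∧
      (∀ k : ℕ, 0 < r k) ∧
      Tendsto r atTop (nhds 0) ∧
      (∀ k l : ℕ, k ≠ l → Disjoint (closedBall (a k) (r k)) (closedBall (a l) (r l))) ∧
      (∀ z : ℂ, f z = 0 → ∃ k : ℕ, z ∈ closedBall (a k) (r k)) ∧
      (∀ z : ℂ, z ∉ ⋃ k : ℕ, closedBall (a k) (r k) →
        ‖deriv f z / f z‖ ≤ C' * ‖z‖ ^ N) := by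
  obtain ⟨p, hp⟩ := hfne
  obtain ⟨c, hc, hgrowth⟩ := exists_growth_of_norm_le hρ hC hbound hp
  obtain ⟨D, u, hD, huc, hupos, husum, hzero, hle⟩ :=
    exists_disks_norm_deriv_div_le (f := fun z => f (z + p)) (by fun_prop) (by simpa) hc hρ
      (by simpa using hgrowth)
  have : Countable u := huc.to_subtype
  let b : u ⊕ ℕ → ℂ := Sum.elim (fun q => q.1.1 + p) (fun k => k)
  let s : u ⊕ ℕ → ℝ := Sum.elim (fun q => q.1.2) (fun k => (1 / 2) ^ k)
  obtain ⟨a, r, hr, hr0, hdisj, hcov⟩ := exists_seq_pairwise_disjoint_merge (a := b) (r := s)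
    (by
      rintro (q | k)
      · exact hupos q.1 q.2
      · simp only [s, Sum.elim_inr]; positivity)
    (Summable.sum s husum summable_geometric_two)
    (fun B => by
      obtain ⟨n, hn⟩ := exists_nat_gt B
      exact ⟨Sum.inr n, by simpa [b] using hn⟩)
  have hmem : ∀ z, ∀ q ∈ u, z - p ∈ closedBall q.1 q.2 → ∃ k, z ∈ closedBall (a k) (r k) := by
    intro z q hq hz
    obtain ⟨k, hk⟩ := hcov (Sum.inl ⟨q, hq⟩)
    refine ⟨k, hk ?_⟩
    rw [mem_closedBall, dist_eq_norm] at hz ⊢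
    simp only [b, s, Sum.elim_inl]
    rwa [← sub_sub, sub_right_comm]
  refine ⟨D * (2 + ‖p‖) ^ N, a, r, by positivity, hr, hr0, hdisj, fun z hz => ?_, fun z hz => ?_⟩
  · obtain ⟨q, hq, h⟩ := hzero (z - p) (by simpa using hz)
    exact hmem z q hq h
  · rw [Set.mem_iUnion] at hz
    have hz1 : 1 ≤ ‖z‖ := by
      by_contra! hlt
      obtain ⟨k, hk⟩ := hcov (Sum.inr 0)
      exact hz ⟨k, hk (by simpa [b, s] using hlt.le)⟩
    have h := hle (z - p) fun q hq h => hz (hmem z q hq h)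
    rw [deriv_comp_add_const, sub_add_cancel] at h
    calc ‖deriv f z / f z‖ ≤ D * (1 + ‖z - p‖) ^ (ρ + 2) := h
      _ ≤ D * (1 + ‖z - p‖) ^ (N : ℝ) := by
          gcongr
          simp
      _ = D * (1 + ‖z - p‖) ^ N := by rw [Real.rpow_natCast]
      _ ≤ D * ((2 + ‖p‖) * ‖z‖) ^ N := by
          gcongr
          nlinarith [norm_sub_le z p, norm_nonneg p]
      _ = _ := by rw [mul_pow]; ring
end
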